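/- arXiv:2009.12685 — 2 statements merged into one kernel-verified Lean document; each statement's English description precedes it below -/
import Mathlib

section
/- Let d ≥ 1 and 0 ≤ k ≤ d−1. Let A₁, …, A_k, S₁, …, S_{d−k−1}, T₁, …, T_{d−k−1} be independent standard Gaussian random vectors in ℝ^d. Let B_S be the (ε/2)-neighborhood of span{A₁, …, A_k, S₁, …, S_{d−k−1}} and B_T the (ε/2)-neighborhood of span{A₁, …, A_k, T₁, …, T_{d−k−1}}. Then for every t ≥ 1, ℙ( 𝒢(B_S ∩ B_T) ≥ ε²·t/√(2π) ) ≤ 1/t^{d−k−2}. -/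
open MeasureTheory ProbabilityTheory

/-- The standard Gaussian probability measure on `ℝ^d`. -/
noncomputable def stdGaussian (d : ℕ) : Measure (EuclideanSpace ℝ (Fin d)) :=
  (Measure.pi fun _ : Fin d => gaussianReal 0 1).map
    (MeasurableEquiv.toLp 2 (Fin d → ℝ))

section GaussianEstimates

variable {E : Type*} [NormedAddCommGroup E] [InnerProductSpace ℝ E] [FiniteDimensional ℝ E]
  [MeasurableSpace E] [BorelSpace E]

/-- The coordinates of a standard Gaussian vector along an orthonormal family are independent
standard Gaussian variables. -/
lemma stdGaussian_map_inner_orthonormal {ι : Type*} [Fintype ι] {e : ι → E}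
    (he : Orthonormal ℝ e) :
    (ProbabilityTheory.stdGaussian E).map (fun x i => inner ℝ (e i) x) =
      Measure.pi fun _ : ι => gaussianReal 0 1 := by
  have key : (ProbabilityTheory.stdGaussian E).map
      (fun x => WithLp.toLp 2 fun i => inner ℝ (e i) x) =
      ProbabilityTheory.stdGaussian (EuclideanSpace ℝ ι) := by
    apply Measure.ext_of_charFun
    ext s
    rw [charFun_stdGaussian, charFun_apply,
      integral_map (Measurable.aemeasurable (by fun_prop))
        (Measurable.aestronglyMeasurable (by fun_prop))]
    have h1 : ∀ x : E, inner ℝ (WithLp.toLp 2 fun i => inner ℝ (e i) x : EuclideanSpace ℝ ι) s =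
        inner ℝ x (∑ i, s i • e i) := by
      intro x
      simp [PiLp.inner_apply, inner_sum, inner_smul_right, real_inner_comm]
    have h2 : ‖∑ i, s i • e i‖ ^ 2 = ‖s‖ ^ 2 := by
      rw [← real_inner_self_eq_norm_sq, he.inner_sum, EuclideanSpace.real_norm_sq_eq]
      simp [pow_two]
    simp_rw [h1]
    rw [← charFun_apply, charFun_stdGaussian]
    norm_cast
    rw [h2]
  rw [← map_pi_eq_stdGaussian] at key
  have := congrArg (fun μ => Measure.map (WithLp.ofLp : EuclideanSpace ℝ ι → ι → ℝ) μ) key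
  simp only at this
  rwa [Measure.map_map (by fun_prop) (by fun_prop), Measure.map_map (by fun_prop) (by fun_prop),
    show (WithLp.ofLp : EuclideanSpace ℝ ι → ι → ℝ) ∘ WithLp.toLp 2 = id from rfl,
    Measure.map_id] at this

lemma gaussianReal_zero_one_le_volume (s : Set ℝ) :
    gaussianReal 0 1 s ≤ ENNReal.ofReal (√(2 * Real.pi))⁻¹ * volume s := by
  rw [gaussianReal_apply 0 one_ne_zero, ← setLIntegral_const]
  refine lintegral_mono fun x => ENNReal.ofReal_le_ofReal ?_
  simp only [gaussianPDFReal_def, NNReal.coe_one, mul_one, sub_zero]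
  refine mul_le_of_le_one_right (by positivity) (Real.exp_le_one_iff.2 ?_)
  have := sq_nonneg x
  linarith

lemma gaussianReal_zero_one_slab_le (a r : ℝ) {σ : ℝ} (hσ : 0 < σ) :
    gaussianReal 0 1 {y | |a + σ * y| ≤ r} ≤
      ENNReal.ofReal (2 * r / (σ * √(2 * Real.pi))) := by
  have hsub : {y | |a + σ * y| ≤ r} ⊆ Set.Icc ((-r - a) / σ) ((r - a) / σ) := by
    intro y hy
    rw [Set.mem_ofPred_eq, abs_le] at hy
    obtain ⟨h1, h2⟩ := hy
    constructor
    · rw [div_le_iff₀ hσ]; linarith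
    · rw [le_div_iff₀ hσ]; linarith
  refine (measure_mono hsub).trans ((gaussianReal_zero_one_le_volume _).trans ?_)
  rw [Real.volume_Icc, ← ENNReal.ofReal_mul (by positivity)]
  refine le_of_eq (congrArg _ ?_)
  field_simp
  ring

/-- The Gaussian measure of the intersection of two slabs of half-width `r` whose unit normals
span an angle with sine `σ`. -/
lemma stdGaussian_inter_slab_le {u v : E} (hu : ‖u‖ = 1) (hv : ‖v‖ = 1) {r : ℝ}
    (hr : 0 ≤ r) (h : 0 < 1 - inner ℝ u v ^ 2) :
    ProbabilityTheory.stdGaussian E {x | |inner ℝ u x| ≤ r ∧ |inner ℝ v x| ≤ r} ≤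
      ENNReal.ofReal ((2 * r) ^ 2 / (2 * Real.pi * √(1 - inner ℝ u v ^ 2))) := by
  set c : ℝ := inner ℝ u v with hc
  set σ : ℝ := √(1 - c ^ 2) with hσdef
  have hσ : 0 < σ := Real.sqrt_pos.2 h
  have hσ2 : σ ^ 2 = 1 - c ^ 2 := Real.sq_sqrt h.le
  set w : E := σ⁻¹ • (v - c • u) with hw
  have huu : inner ℝ u u = (1 : ℝ) := by rw [real_inner_self_eq_norm_sq, hu, one_pow]
  have hvv : inner ℝ v v = (1 : ℝ) := by rw [real_inner_self_eq_norm_sq, hv, one_pow]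
  have hvu : inner ℝ v u = c := by rw [real_inner_comm]
  have huw : inner ℝ u w = (0 : ℝ) := by
    simp [hw, inner_smul_right, inner_sub_right, hu, ← hc]
  have hww : inner ℝ w w = (1 : ℝ) := by
    simp only [hw, inner_smul_right, inner_smul_left, inner_sub_right, inner_sub_left, huu, hvv,
      hvu, ← hc, RCLike.conj_to_real]
    field_simp
    linarith
  have hw1 : ‖w‖ = 1 := by rw [norm_eq_sqrt_real_inner, hww, Real.sqrt_one]
  have hvw : v = c • u + σ • w := by
    rw [hw, smul_inv_smul₀ hσ.ne']; abel
  have he : Orthonormal ℝ ![u, w] := by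
    rw [orthonormal_iff_ite]
    intro i j
    have hwu : inner ℝ w u = (0 : ℝ) := by rw [real_inner_comm, huw]
    fin_cases i <;> fin_cases j <;> simp [hu, hw1, huw, hwu]
  have hmp : MeasurePreserving (fun x : E => ((inner ℝ u x : ℝ), (inner ℝ w x : ℝ)))
      (ProbabilityTheory.stdGaussian E) ((gaussianReal 0 1).prod (gaussianReal 0 1)) := by
    have h1 : MeasurePreserving (fun x (i : Fin 2) => (inner ℝ (![u, w] i) x : ℝ))
        (ProbabilityTheory.stdGaussian E) (Measure.pi fun _ : Fin 2 => gaussianReal 0 1) :=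
      ⟨by fun_prop, stdGaussian_map_inner_orthonormal he⟩
    exact (measurePreserving_piFinTwo (fun _ : Fin 2 => gaussianReal 0 1)).comp h1
  set D : Set (ℝ × ℝ) := {p | |p.1| ≤ r ∧ |c * p.1 + σ * p.2| ≤ r} with hD
  have hDm : MeasurableSet D := by
    rw [hD, Set.ofPred_and]
    exact (measurableSet_le (by fun_prop) measurable_const).inter
      (measurableSet_le (by fun_prop) measurable_const)
  have hpre : {x : E | |inner ℝ u x| ≤ r ∧ |inner ℝ v x| ≤ r} =
      (fun x : E => ((inner ℝ u x : ℝ), (inner ℝ w x : ℝ))) ⁻¹' D := by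
    ext x
    have : inner ℝ v x = c * inner ℝ u x + σ * inner ℝ w x := by
      conv_lhs => rw [hvw]
      simp [inner_add_left, inner_smul_left]
    simp [hD, this]
  rw [hpre, hmp.measure_preimage hDm.nullMeasurableSet, Measure.prod_apply hDm]
  set C : ENNReal := ENNReal.ofReal (2 * r / (σ * √(2 * Real.pi))) with hC
  calc ∫⁻ a, gaussianReal 0 1 (Prod.mk a ⁻¹' D) ∂gaussianReal 0 1
      ≤ ∫⁻ a, {y : ℝ | |0 + 1 * y| ≤ r}.indicator (fun _ => C) a ∂gaussianReal 0 1 := by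
        refine lintegral_mono fun a => ?_
        by_cases ha : |a| ≤ r
        · rw [Set.indicator_of_mem (by simpa using ha)]
          exact (measure_mono fun y hy => hy.2).trans (gaussianReal_zero_one_slab_le (c * a) r hσ)
        · have : Prod.mk a ⁻¹' D = ∅ := by
            ext y; simp [hD, ha]
          simp [this]
    _ ≤ C * gaussianReal 0 1 {y : ℝ | |0 + 1 * y| ≤ r} := by
        refine lintegral_indicator_const_le _ _
    _ ≤ C * ENNReal.ofReal (2 * r / (1 * √(2 * Real.pi))) := by
        gcongr
        exact gaussianReal_zero_one_slab_le 0 r one_pos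
    _ = _ := by
        rw [hC, ← ENNReal.ofReal_mul (by positivity)]
        congr 1
        have := Real.sq_sqrt (show 0 ≤ 2 * Real.pi by positivity)
        field_simp
        rw [this]
        ring

lemma integrable_exp_mul_sq_gaussianReal {q : ℝ} (hq : q < 1 / 2) :
    Integrable (fun x => Real.exp (q * x ^ 2)) (gaussianReal 0 1) := by
  rw [gaussianReal_of_var_ne_zero 0 one_ne_zero,
    integrable_withDensity_iff_integrable_smul' (by fun_prop) (by simp [gaussianPDF_lt_top])]
  have h := (integrable_exp_neg_mul_sq (b := 1 / 2 - q) (by linarith)).const_mul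
    (√(2 * Real.pi))⁻¹
  refine h.congr (Filter.Eventually.of_forall fun x => ?_)
  simp only [toReal_gaussianPDF, gaussianPDFReal_def, smul_eq_mul, NNReal.coe_one, mul_one,
    sub_zero]
  rw [mul_assoc, ← Real.exp_add]
  ring_nf

lemma integral_exp_mul_sq_gaussianReal {q : ℝ} (hq : q < 1 / 2) :
    ∫ x, Real.exp (q * x ^ 2) ∂gaussianReal 0 1 = (√(1 - 2 * q))⁻¹ := by
  rw [integral_gaussianReal_eq_integral_smul one_ne_zero]
  have h : ∀ x : ℝ, gaussianPDFReal 0 1 x • Real.exp (q * x ^ 2) =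
      (√(2 * Real.pi))⁻¹ * Real.exp (-(1 / 2 - q) * x ^ 2) := by
    intro x
    simp only [gaussianPDFReal_def, smul_eq_mul, NNReal.coe_one, mul_one, sub_zero]
    rw [mul_assoc, ← Real.exp_add]
    ring_nf
  simp_rw [h]
  rw [integral_const_mul, integral_gaussian, ← Real.sqrt_inv, ← Real.sqrt_mul (by positivity),
    ← Real.sqrt_inv]
  congr 1
  have : 1 / 2 - q ≠ 0 := by linarith
  have : 1 - 2 * q ≠ 0 := by linarith
  field_simp

/-- A Gaussian vector is unlikely to lie in a thin cone around a coordinate axis. -/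
lemma pi_gaussianReal_cone_le (m : ℕ) {t : ℝ} (ht : 1 ≤ t) :
    (Measure.pi fun _ : Fin (m + 1) => gaussianReal 0 1)
      {x | (1 - (2 * Real.pi * t ^ 2)⁻¹) * ∑ i : Fin m, x i.succ ^ 2 ≤
        (2 * Real.pi * t ^ 2)⁻¹ * x 0 ^ 2} ≤ ENNReal.ofReal (1 / t ^ m) := by
  rcases Nat.eq_zero_or_pos m with rfl | hm
  · simpa using prob_le_one
  have ht0 : 0 < t := by linarith
  have hpi : 3 < Real.pi := Real.pi_gt_three
  have ht2 : 1 ≤ t ^ 2 := one_le_pow₀ ht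
  set q : Fin (m + 1) → ℝ := Fin.cons (1 / 4) fun _ => 1 / 4 - Real.pi * t ^ 2 / 2 with hq
  have hqlt : ∀ i, q i < 1 / 2 := by
    intro i
    refine Fin.cases ?_ (fun j => ?_) i
    · simp [hq]; norm_num
    · simp only [hq, Fin.cons_succ]; nlinarith
  set f : (Fin (m + 1) → ℝ) → ℝ := fun x => ∏ i, Real.exp (q i * x i ^ 2) with hf
  have hfint : Integrable f (Measure.pi fun _ : Fin (m + 1) => gaussianReal 0 1) :=
    Integrable.fintype_prod fun i => integrable_exp_mul_sq_gaussianReal (hqlt i)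
  have hfI : ∫ x, f x ∂(Measure.pi fun _ : Fin (m + 1) => gaussianReal 0 1) =
      (√(1 / 2))⁻¹ * ((√(1 / 2 + Real.pi * t ^ 2))⁻¹) ^ m := by
    rw [hf, integral_fintype_prod_eq_prod (fun i (y : ℝ) => Real.exp (q i * y ^ 2))]
    simp_rw [integral_exp_mul_sq_gaussianReal (hqlt _)]
    rw [Fin.prod_univ_succ]
    simp only [hq, Fin.cons_zero, Fin.cons_succ, Finset.prod_const, Finset.card_univ,
      Fintype.card_fin]
    congr 3 <;> ring_nf
  have hsub : {x : Fin (m + 1) → ℝ | (1 - (2 * Real.pi * t ^ 2)⁻¹) * ∑ i : Fin m, x i.succ ^ 2 ≤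
        (2 * Real.pi * t ^ 2)⁻¹ * x 0 ^ 2} ⊆ {x | 1 ≤ f x} := by
    intro x hx
    simp only [Set.mem_ofPred_eq, hf] at hx ⊢
    rw [← Real.exp_sum, Real.one_le_exp_iff, Fin.sum_univ_succ]
    simp only [hq, Fin.cons_zero, Fin.cons_succ]
    rw [← Finset.mul_sum]
    have hpt : 0 < Real.pi * t ^ 2 / 2 := by positivity
    have := mul_le_mul_of_nonneg_left hx hpt.le
    have e1 : Real.pi * t ^ 2 / 2 * ((2 * Real.pi * t ^ 2)⁻¹ * x 0 ^ 2) = 1 / 4 * x 0 ^ 2 := by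
      field_simp; ring
    have e2 : Real.pi * t ^ 2 / 2 * ((1 - (2 * Real.pi * t ^ 2)⁻¹) * ∑ i : Fin m, x i.succ ^ 2) =
        (Real.pi * t ^ 2 / 2 - 1 / 4) * ∑ i : Fin m, x i.succ ^ 2 := by
      field_simp; ring
    rw [e1, e2] at this
    linarith
  have hmarkov := mul_meas_ge_le_integral_of_nonneg
    (Filter.Eventually.of_forall fun x => Finset.prod_nonneg fun i _ => (Real.exp_pos _).le)
    hfint 1
  rw [one_mul, hfI] at hmarkov
  refine (measure_mono hsub).trans ?_
  rw [← ofReal_measureReal]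
  refine ENNReal.ofReal_le_ofReal (hmarkov.trans ?_)
  have h2 : (√(1 / 2 + Real.pi * t ^ 2))⁻¹ ≤ √(1 / 2) * t⁻¹ := by
    rw [← Real.sqrt_inv, show t⁻¹ = √(t⁻¹ ^ 2) from (Real.sqrt_sq (by positivity)).symm,
      ← Real.sqrt_mul (by norm_num)]
    refine Real.sqrt_le_sqrt ?_
    rw [inv_le_comm₀ (by positivity) (by positivity)]
    field_simp
    nlinarith
  have h3 : √(1 / 2 : ℝ) ≤ 1 := Real.sqrt_le_one.2 (by norm_num)
  have h4 : 0 < √(1 / 2 : ℝ) := Real.sqrt_pos.2 (by norm_num)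
  obtain ⟨n, rfl⟩ : ∃ n, m = n + 1 := ⟨m - 1, by omega⟩
  calc (√(1 / 2))⁻¹ * ((√(1 / 2 + Real.pi * t ^ 2))⁻¹) ^ (n + 1)
      ≤ (√(1 / 2))⁻¹ * (√(1 / 2) * t⁻¹) ^ (n + 1) := by gcongr
    _ = √(1 / 2) ^ n * (1 / t ^ (n + 1)) := by
        rw [mul_pow, pow_succ, inv_pow]; field_simp
    _ ≤ 1 * (1 / t ^ (n + 1)) := by
        gcongr
        exact pow_le_one₀ h4.le h3
    _ = 1 / t ^ (n + 1) := one_mul _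

end GaussianEstimates

section ConeEstimates

lemma measurableSet_forall_imp_nonpos {X K : Type*} [TopologicalSpace X] [MeasurableSpace X]
    [OpensMeasurableSpace X] [TopologicalSpace K] [CompactSpace K] {C : Set (X × K)}
    (hC : IsClosed C) {h : X × K → ℝ} (hh : Continuous h) :
    MeasurableSet {x | ∀ k, (x, k) ∈ C → h (x, k) ≤ 0} := by
  have heq : {x | ∀ k, (x, k) ∈ C → h (x, k) ≤ 0} =
      (⋃ n : ℕ, Prod.fst '' (C ∩ h ⁻¹' Set.Ici (1 / ((n : ℝ) + 1))))ᶜ := by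
    ext x
    simp only [Set.mem_ofPred_eq, Set.mem_compl_iff, Set.mem_iUnion, not_exists]
    constructor
    · rintro hx n ⟨⟨x', k⟩, ⟨hk, hk'⟩, rfl⟩
      have h1 : 1 / ((n : ℝ) + 1) ≤ h (x', k) := hk'
      have h2 : 0 < 1 / ((n : ℝ) + 1) := by positivity
      exact absurd (hx k hk) (by linarith)
    · intro hx k hk
      by_contra! hpos
      obtain ⟨n, hn⟩ := exists_nat_one_div_lt hpos
      exact hx n ⟨(x, k), ⟨hk, hn.le⟩, rfl⟩
  rw [heq]
  exact (MeasurableSet.iUnion fun n => (isClosedMap_fst_of_compactSpace _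
    (hC.inter (isClosed_Ici.preimage hh))).measurableSet).compl

lemma measure_pi_sum_le {ι κ F : Type*} [Fintype ι] [Fintype κ] [MeasurableSpace F]
    (μ : Measure F) [IsProbabilityMeasure μ] {N : Set (ι ⊕ κ → F)} (hN : MeasurableSet N)
    {c : ENNReal}
    (h : ∀ a : ι → F, (Measure.pi fun _ : κ => μ) {b | Sum.elim a b ∈ N} ≤ c) :
    (Measure.pi fun _ : ι ⊕ κ => μ) N ≤ c := by
  have hmp := measurePreserving_sumPiEquivProdPi_symm (X := fun _ : ι ⊕ κ => F) fun _ => μ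
  rw [← hmp.measure_preimage hN.nullMeasurableSet, Measure.prod_apply (hmp.measurable hN)]
  calc _ ≤ ∫⁻ _ : ι → F, c ∂(Measure.pi fun _ : ι => μ) := by
        refine lintegral_mono fun a => le_trans (measure_mono fun b hb => ?_) (h a)
        have : (MeasurableEquiv.sumPiEquivProdPi fun _ : ι ⊕ κ => F).symm (a, b) =
            Sum.elim a b := by
          ext i; cases i <;> rfl
        rw [Set.mem_ofPred_eq, ← this]
        exact hb
    _ = c := by simp

variable {E : Type*} [NormedAddCommGroup E] [InnerProductSpace ℝ E] [FiniteDimensional ℝ E]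

lemma finrank_orthogonal_span_range {ι : Type*} [Fintype ι] (B : ι → E) :
    Module.finrank ℝ E ≤
      Fintype.card ι + Module.finrank ℝ (Submodule.span ℝ (Set.range B))ᗮ := by
  have h1 := (Submodule.span ℝ (Set.range B)).finrank_add_finrank_orthogonal
  have h2 : Module.finrank ℝ (Submodule.span ℝ (Set.range B)) ≤ Fintype.card ι :=
    finrank_range_le_card B
  omega

lemma mem_orthogonal_span_range {ι : Type*} {B : ι → E} {x : E} :
    x ∈ (Submodule.span ℝ (Set.range B))ᗮ ↔ ∀ i, inner ℝ x (B i) = 0 := by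
  rw [← Submodule.span_singleton_le_iff_mem, Submodule.le_orthogonal_iff_le_orthogonal,
    Submodule.span_le]
  simp only [Set.range_subset_iff, SetLike.mem_coe, Submodule.mem_orthogonal_singleton_iff_inner_right]

lemma exists_sphere_orthogonal {ι : Type*} [Fintype ι] (B : ι → E)
    (h : Fintype.card ι < Module.finrank ℝ E) :
    ∃ v : Metric.sphere (0 : E) 1, ∀ i, inner ℝ (v : E) (B i) = 0 := by
  have h1 := finrank_orthogonal_span_range B
  have : Nontrivial (Submodule.span ℝ (Set.range B))ᗮ :=
    Module.nontrivial_of_finrank_pos (R := ℝ) (by omega)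
  obtain ⟨x, hx⟩ := exists_norm_eq (Submodule.span ℝ (Set.range B))ᗮ (zero_le_one' ℝ)
  exact ⟨⟨x, by simpa using hx⟩, mem_orthogonal_span_range.1 x.2⟩

variable [MeasurableSpace E] [BorelSpace E]

lemma stdGaussian_cone_le {ι : Type*} [Fintype ι] (A : ι → E) (v : Metric.sphere (0 : E) 1)
    (hv : ∀ i, inner ℝ (v : E) (A i) = 0) {m : ℕ}
    (hm : Fintype.card ι + 1 + m ≤ Module.finrank ℝ E) {t : ℝ} (ht : 1 ≤ t) :
    ProbabilityTheory.stdGaussian E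
      {g | ‖(Submodule.span ℝ (Set.range A))ᗮ.starProjection g‖ ^ 2 - inner ℝ (v : E) g ^ 2 ≤
        (2 * Real.pi * t ^ 2)⁻¹ *
          ‖(Submodule.span ℝ (Set.range A))ᗮ.starProjection g‖ ^ 2} ≤
      ENNReal.ofReal (1 / t ^ m) := by
  set W := (Submodule.span ℝ (Set.range A))ᗮ with hW
  set U := (Submodule.span ℝ (Set.range (fun o : Option ι => o.elim (v : E) A)))ᗮ with hU
  have hmU : m ≤ Module.finrank ℝ U := by
    have := finrank_orthogonal_span_range (fun o : Option ι => o.elim (v : E) A)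
    rw [Fintype.card_option, ← hU] at this
    omega
  set w : Fin m → E := fun i => stdOrthonormalBasis ℝ U (Fin.castLE hmU i) with hw
  have hwU : ∀ i o, inner ℝ (w i) (Option.elim o (v : E) A) = 0 := fun i =>
    mem_orthogonal_span_range.1 (stdOrthonormalBasis ℝ U (Fin.castLE hmU i)).2
  have hwo : Orthonormal ℝ w :=
    ((stdOrthonormalBasis ℝ U).orthonormal.comp _ (Fin.castLE_injective hmU)).comp_linearIsometry
      U.subtypeₗᵢ
  have he : Orthonormal ℝ (Matrix.vecCons (v : E) w) := by
    rw [orthonormal_vecCons_iff]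
    refine ⟨by simp, fun i => ?_, hwo⟩
    rw [real_inner_comm]
    exact hwU i none
  have heW : ∀ i, Matrix.vecCons (v : E) w i ∈ W := by
    intro i
    refine Fin.cases ?_ (fun j => ?_) i
    · exact mem_orthogonal_span_range.2 hv
    · exact mem_orthogonal_span_range.2 fun l => hwU j (some l)
  have hin : ∀ i g, inner ℝ (Matrix.vecCons (v : E) w i) (W.starProjection g) =
      inner ℝ (Matrix.vecCons (v : E) w i) g := by
    intro i g
    rw [← Submodule.inner_starProjection_left_eq_right,
      Submodule.starProjection_eq_self_iff.2 (heW i)]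
  refine le_trans ?_ (pi_gaussianReal_cone_le m ht)
  rw [← stdGaussian_map_inner_orthonormal he]
  refine le_trans (measure_mono fun g hg => ?_)
    (Measure.le_map_apply (Measurable.aemeasurable (by fun_prop)) _)
  rw [Set.mem_ofPred_eq] at hg
  simp only [Set.mem_preimage, Set.mem_ofPred_eq, Matrix.cons_val_zero, Matrix.cons_val_succ]
  have hb := he.sum_inner_products_le (x := W.starProjection g) (s := Finset.univ)
  simp only [hin, Fin.sum_univ_succ, Real.norm_eq_abs, sq_abs, Matrix.cons_val_zero,
    Matrix.cons_val_succ] at hb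
  have hs : (2 * Real.pi * t ^ 2)⁻¹ ≤ 1 := by
    refine inv_le_one_of_one_le₀ ?_
    nlinarith [Real.pi_gt_three, one_le_pow₀ ht (n := 2)]
  nlinarith

/-- Rotation invariance: in the event that `u` is close to every unit normal of `A` and `T`, the
unit vector `u` may be replaced by the projection of any vector to the orthogonal complement
of `A`. -/
lemma pi_stdGaussian_le_of_orthogonal {ι κ : Type*} [Fintype κ] (A : ι → E)
    (u : Metric.sphere (0 : E) 1) (hu : ∀ i, inner ℝ (u : E) (A i) = 0) (s : ℝ) (g : E) :
    (Measure.pi fun _ : κ => ProbabilityTheory.stdGaussian E)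
      {T | ∀ v : Metric.sphere (0 : E) 1, (∀ i, inner ℝ (v : E) (A i) = 0) →
        (∀ j, inner ℝ (v : E) (T j) = 0) → 1 - inner ℝ (v : E) (u : E) ^ 2 ≤ s} ≤
    (Measure.pi fun _ : κ => ProbabilityTheory.stdGaussian E)
      {T | ∀ v : Metric.sphere (0 : E) 1, (∀ i, inner ℝ (v : E) (A i) = 0) →
        (∀ j, inner ℝ (v : E) (T j) = 0) →
        ‖(Submodule.span ℝ (Set.range A))ᗮ.starProjection g‖ ^ 2 - inner ℝ (v : E) g ^ 2 ≤
          s * ‖(Submodule.span ℝ (Set.range A))ᗮ.starProjection g‖ ^ 2} := by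
  set W := (Submodule.span ℝ (Set.range A))ᗮ with hW
  set p := W.starProjection g with hp
  by_cases hp0 : p = 0
  · refine measure_mono fun T _ v _ _ => ?_
    simp only [hp0, norm_zero]
    nlinarith [sq_nonneg (inner ℝ (v : E) g)]
  have hpn : 0 < ‖p‖ := norm_pos_iff.2 hp0
  have hpA : ∀ i, inner ℝ p (A i) = 0 :=
    mem_orthogonal_span_range.1 (W.starProjection_apply_mem g)
  set u' : E := ‖p‖⁻¹ • p with hu'
  have hnorm : ‖(u : E)‖ = ‖u'‖ := by
    rw [hu', norm_smul, norm_inv, norm_norm, inv_mul_cancel₀ hpn.ne']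
    simp
  set R := (ℝ ∙ ((u : E) - u'))ᗮ.reflection with hR
  have hRu : R u = u' := Submodule.reflection_sub hnorm
  have hRR : ∀ x, R (R x) = x := Submodule.reflection_reflection _
  have hRi : ∀ x y, inner ℝ (R x) y = inner ℝ x (R y) := fun x y => by
    rw [← R.inner_map_map, hRR]
  have hRA : ∀ i, R (A i) = A i := by
    intro i
    refine Submodule.reflection_mem_subspace_eq_self ?_
    rw [Submodule.mem_orthogonal_singleton_iff_inner_right, inner_sub_left, hu i, hu',
      inner_smul_left, hpA i]
    simp
  have hmp : MeasurePreserving (fun (T : κ → E) j => R (T j))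
      (Measure.pi fun _ : κ => ProbabilityTheory.stdGaussian E)
      (Measure.pi fun _ : κ => ProbabilityTheory.stdGaussian E) :=
    measurePreserving_pi _ _ fun _ => ⟨R.continuous.measurable, stdGaussian_map R⟩
  conv_rhs => rw [← hmp.map_eq]
  refine le_trans (measure_mono fun T hT => ?_)
    (Measure.le_map_apply hmp.measurable.aemeasurable _)
  rw [Set.mem_preimage, Set.mem_ofPred_eq]
  intro v hvA hvT
  have h1 : 1 - inner ℝ (R v) (u : E) ^ 2 ≤ s := by
    refine hT ⟨R v, by simp⟩ (fun i => ?_) fun j => ?_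
    · rw [hRi, hRA, hvA]
    · rw [hRi]; exact hvT j
  have h2 : inner ℝ (R v) (u : E) = ‖p‖⁻¹ * inner ℝ (v : E) g := by
    rw [hRi, hRu, hu', inner_smul_right, hp, ← Submodule.inner_starProjection_left_eq_right,
      Submodule.starProjection_eq_self_iff.2 (mem_orthogonal_span_range.2 hvA)]
  rw [h2] at h1
  have h3 := mul_le_mul_of_nonneg_right h1 (sq_nonneg ‖p‖)
  have h4 : (1 - (‖p‖⁻¹ * inner ℝ (v : E) g) ^ 2) * ‖p‖ ^ 2 =
      ‖p‖ ^ 2 - inner ℝ (v : E) g ^ 2 := by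
    field_simp
  rwa [h4] at h3

lemma pi_stdGaussian_normal_le {ι κ : Type*} [Fintype ι] [Fintype κ] (A : ι → E)
    (u : Metric.sphere (0 : E) 1) (hu : ∀ i, inner ℝ (u : E) (A i) = 0) {m : ℕ}
    (hm : Fintype.card ι + 1 + m ≤ Module.finrank ℝ E)
    (hκ : Fintype.card ι + Fintype.card κ < Module.finrank ℝ E) {t : ℝ} (ht : 1 ≤ t) :
    (Measure.pi fun _ : κ => ProbabilityTheory.stdGaussian E)
      {T | ∀ v : Metric.sphere (0 : E) 1, (∀ i, inner ℝ (v : E) (A i) = 0) →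
        (∀ j, inner ℝ (v : E) (T j) = 0) →
        1 - inner ℝ (v : E) (u : E) ^ 2 ≤ (2 * Real.pi * t ^ 2)⁻¹} ≤
      ENNReal.ofReal (1 / t ^ m) := by
  set s : ℝ := (2 * Real.pi * t ^ 2)⁻¹ with hs
  set γ := ProbabilityTheory.stdGaussian E with hγ
  set P := (Submodule.span ℝ (Set.range A))ᗮ.starProjection with hP
  set Q : Set (E × (κ → E)) := {x | ∀ v : Metric.sphere (0 : E) 1,
    (x, v) ∈ {y : (E × (κ → E)) × Metric.sphere (0 : E) 1 |
      (∀ i, inner ℝ (y.2 : E) (A i) = 0) ∧ ∀ j, inner ℝ (y.2 : E) (y.1.2 j) = 0} →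
    ‖P x.1‖ ^ 2 - inner ℝ (v : E) x.1 ^ 2 - s * ‖P x.1‖ ^ 2 ≤ 0} with hQ
  set G : Set (κ → E) := {T | ∀ v : Metric.sphere (0 : E) 1,
    (∀ i, inner ℝ (v : E) (A i) = 0) → (∀ j, inner ℝ (v : E) (T j) = 0) →
      1 - inner ℝ (v : E) (u : E) ^ 2 ≤ s} with hG
  have : ProperSpace E := FiniteDimensional.proper ℝ E
  have hQm : MeasurableSet Q := by
    refine measurableSet_forall_imp_nonpos
      (h := fun y : (E × (κ → E)) × Metric.sphere (0 : E) 1 =>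
        ‖P y.1.1‖ ^ 2 - inner ℝ (y.2 : E) y.1.1 ^ 2 - s * ‖P y.1.1‖ ^ 2) ?_
      (by fun_prop)
    simp only [Set.ofPred_and, Set.ofPred_forall]
    refine IsClosed.inter (isClosed_iInter fun i => ?_) (isClosed_iInter fun j => ?_)
    · exact isClosed_eq (by fun_prop) (by fun_prop)
    · exact isClosed_eq (by fun_prop) (by fun_prop)
  calc (Measure.pi fun _ : κ => γ) G
      = ∫⁻ _ : E, (Measure.pi fun _ : κ => γ) G ∂γ := by simp
    _ ≤ ∫⁻ g : E, (Measure.pi fun _ : κ => γ) (Prod.mk g ⁻¹' Q) ∂γ := by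
        refine lintegral_mono fun g =>
          (pi_stdGaussian_le_of_orthogonal A u hu s g).trans
            (measure_mono fun T hT v hv => ?_)
        exact sub_nonpos.2 (hT v hv.1 hv.2)
    _ = (γ.prod (Measure.pi fun _ : κ => γ)) Q := (Measure.prod_apply hQm).symm
    _ = ∫⁻ T : κ → E, γ ((fun g => (g, T)) ⁻¹' Q) ∂(Measure.pi fun _ : κ => γ) :=
        Measure.prod_apply_symm hQm
    _ ≤ ∫⁻ _ : κ → E, ENNReal.ofReal (1 / t ^ m) ∂(Measure.pi fun _ : κ => γ) := by
        refine lintegral_mono fun T => ?_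
        obtain ⟨v, hv⟩ := exists_sphere_orthogonal (Sum.elim A T) (by simpa using hκ)
        have hvA : ∀ i, inner ℝ (v : E) (A i) = 0 := fun i => hv (.inl i)
        refine (measure_mono fun g hg => ?_).trans (stdGaussian_cone_le A v hvA hm ht)
        exact sub_nonpos.1 (hg v ⟨hvA, fun j => hv (.inr j)⟩)
    _ = _ := by simp

end ConeEstimates

lemma abs_inner_le_of_mem_cthickening_span {E : Type*} [NormedAddCommGroup E]
    [InnerProductSpace ℝ E] [FiniteDimensional ℝ E] {V : Submodule ℝ E} {u x : E} {r : ℝ}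
    (hu : ‖u‖ = 1) (huV : u ∈ Vᗮ) (hr : 0 ≤ r) (hx : x ∈ Metric.cthickening r (V : Set E)) :
    |inner ℝ u x| ≤ r := by
  have : ProperSpace E := FiniteDimensional.proper ℝ E
  rw [V.closed_of_finiteDimensional.cthickening_eq_biUnion_closedBall hr] at hx
  simp only [Set.mem_iUnion, Metric.mem_closedBall, SetLike.mem_coe, exists_prop] at hx
  obtain ⟨y, hy, hxy⟩ := hx
  have : inner ℝ u x = inner ℝ u (x - y) := by
    rw [inner_sub_right, Submodule.inner_left_of_mem_orthogonal hy huV, sub_zero]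
  rw [this]
  refine (abs_real_inner_le_norm _ _).trans ?_
  rwa [hu, one_mul, ← dist_eq_norm]

/-- Lemma: let `1 ≤ d`, `0 ≤ k ≤ d-1`, and let `A₁,…,A_k, S₁,…,S_{d-k-1}, T₁,…,T_{d-k-1}` be
iid standard Gaussian vectors in `ℝ^d`. Let `B_S`, `B_T` be the `(ε/2)`-neighborhoods of
`span{A₁,…,A_k,S₁,…,S_{d-k-1}}` and `span{A₁,…,A_k,T₁,…,T_{d-k-1}}`. Then for every `t ≥ 1`,
`ℙ(𝒢(B_S ∩ B_T) ≥ ε² t / √(2π)) ≤ 1/t^{d-k-2}`. -/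
theorem stmt10 (d k : ℕ) (hd : 1 ≤ d) (hk : k ≤ d - 1) (ε : ℝ) (hε : 0 < ε)
    (t : ℝ) (ht : 1 ≤ t) :
    (Measure.pi fun _ : Fin k ⊕ Fin (d - k - 1) ⊕ Fin (d - k - 1) => stdGaussian d)
        {ω : Fin k ⊕ Fin (d - k - 1) ⊕ Fin (d - k - 1) → EuclideanSpace ℝ (Fin d) |
          ENNReal.ofReal (ε ^ 2 * t / Real.sqrt (2 * Real.pi)) ≤
            stdGaussian d
              (Metric.cthickening (ε / 2)
                  (Submodule.span ℝ
                    ((Set.range fun i : Fin k => ω (Sum.inl i)) ∪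
                      (Set.range fun j : Fin (d - k - 1) => ω (Sum.inr (Sum.inl j)))) :
                    Set (EuclideanSpace ℝ (Fin d))) ∩
                Metric.cthickening (ε / 2)
                  (Submodule.span ℝ
                    ((Set.range fun i : Fin k => ω (Sum.inl i)) ∪
                      (Set.range fun j : Fin (d - k - 1) => ω (Sum.inr (Sum.inr j)))) :
                    Set (EuclideanSpace ℝ (Fin d))))} ≤
      ENNReal.ofReal (1 / t ^ (d - k - 2)) := by
  have hγ : stdGaussian d = ProbabilityTheory.stdGaussian (EuclideanSpace ℝ (Fin d)) :=
    map_pi_eq_stdGaussian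
  rw [hγ]
  set E := EuclideanSpace ℝ (Fin d) with hE
  have hfr : Module.finrank ℝ E = d := finrank_euclideanSpace_fin
  set s : ℝ := (2 * Real.pi * t ^ 2)⁻¹ with hs
  set N : Set (Fin k ⊕ Fin (d - k - 1) ⊕ Fin (d - k - 1) → E) :=
    {ω | ∀ p : Metric.sphere (0 : E) 1 × Metric.sphere (0 : E) 1,
      (ω, p) ∈ {y : (Fin k ⊕ Fin (d - k - 1) ⊕ Fin (d - k - 1) → E) ×
          Metric.sphere (0 : E) 1 × Metric.sphere (0 : E) 1 |
        ((∀ i, inner ℝ (y.2.1 : E) (y.1 (.inl i)) = 0) ∧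
          ∀ j, inner ℝ (y.2.1 : E) (y.1 (.inr (.inl j))) = 0) ∧
        (∀ i, inner ℝ (y.2.2 : E) (y.1 (.inl i)) = 0) ∧
          ∀ j, inner ℝ (y.2.2 : E) (y.1 (.inr (.inr j))) = 0} →
      1 - inner ℝ (p.2 : E) (p.1 : E) ^ 2 - s ≤ 0} with hN
  have hNm : MeasurableSet N := by
    refine measurableSet_forall_imp_nonpos
      (h := fun y : (Fin k ⊕ Fin (d - k - 1) ⊕ Fin (d - k - 1) → E) ×
          Metric.sphere (0 : E) 1 × Metric.sphere (0 : E) 1 =>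
        1 - inner ℝ (y.2.2 : E) (y.2.1 : E) ^ 2 - s) ?_ (by fun_prop)
    simp only [Set.ofPred_and, Set.ofPred_forall]
    refine IsClosed.inter (IsClosed.inter ?_ ?_) (IsClosed.inter ?_ ?_) <;>
      exact isClosed_iInter fun i => isClosed_eq (by fun_prop) (by fun_prop)
  have hbad : ∀ ω : Fin k ⊕ Fin (d - k - 1) ⊕ Fin (d - k - 1) → E,
      ENNReal.ofReal (ε ^ 2 * t / Real.sqrt (2 * Real.pi)) ≤
        ProbabilityTheory.stdGaussian E
          (Metric.cthickening (ε / 2)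
              (Submodule.span ℝ
                ((Set.range fun i : Fin k => ω (Sum.inl i)) ∪
                  (Set.range fun j : Fin (d - k - 1) => ω (Sum.inr (Sum.inl j)))) : Set E) ∩
            Metric.cthickening (ε / 2)
              (Submodule.span ℝ
                ((Set.range fun i : Fin k => ω (Sum.inl i)) ∪
                  (Set.range fun j : Fin (d - k - 1) => ω (Sum.inr (Sum.inr j)))) : Set E)) →
      ω ∈ N := by
    rintro ω hω ⟨u, v⟩ ⟨⟨huA, huS⟩, hvA, hvT⟩
    rw [← Set.Sum.elim_range, ← Set.Sum.elim_range] at hω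
    have hu : ‖(u : E)‖ = 1 := by simp
    have hv : ‖(v : E)‖ = 1 := by simp
    have huV := (mem_orthogonal_span_range (B := Sum.elim (fun i : Fin k => ω (Sum.inl i))
      fun j : Fin (d - k - 1) => ω (Sum.inr (Sum.inl j)))).2 (Sum.rec huA huS)
    have hvV := (mem_orthogonal_span_range (B := Sum.elim (fun i : Fin k => ω (Sum.inl i))
      fun j : Fin (d - k - 1) => ω (Sum.inr (Sum.inr j)))).2 (Sum.rec hvA hvT)
    have hle := hω.trans (measure_mono (t := {x : E | |inner ℝ (v : E) x| ≤ ε / 2 ∧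
      |inner ℝ (u : E) x| ≤ ε / 2}) fun x hx =>
        ⟨abs_inner_le_of_mem_cthickening_span hv hvV (by positivity) hx.2,
          abs_inner_le_of_mem_cthickening_span hu huV (by positivity) hx.1⟩)
    rw [sub_nonpos]
    by_contra! hlt
    have hs0 : 0 < s := by positivity
    have hle' := hle.trans (stdGaussian_inter_slab_le hv hu (by positivity) (hs0.trans hlt))
    rw [ENNReal.ofReal_le_ofReal_iff (by positivity)] at hle'
    have hroot : √s < √(1 - inner ℝ (v : E) (u : E) ^ 2) := Real.sqrt_lt_sqrt hs0.le hlt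
    have hsq : √s = (√(2 * Real.pi) * t)⁻¹ := by
      rw [hs, Real.sqrt_inv, Real.sqrt_mul (by positivity), Real.sqrt_sq (by positivity)]
    refine absurd hle' (not_le.2 ?_)
    have hpi := Real.sq_sqrt (show 0 ≤ 2 * Real.pi by positivity)
    calc (2 * (ε / 2)) ^ 2 / (2 * Real.pi * √(1 - inner ℝ (v : E) (u : E) ^ 2))
        < (2 * (ε / 2)) ^ 2 / (2 * Real.pi * √s) := by
          have : 0 < √s := Real.sqrt_pos.2 hs0
          gcongr
      _ = ε ^ 2 * t / √(2 * Real.pi) := by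
          rw [hsq]
          nth_rewrite 1 [← hpi]
          field_simp
  refine (measure_mono (t := N) fun ω hω => hbad ω hω).trans ?_
  refine (measure_pi_sum_le _ hNm (c := ENNReal.ofReal (1 / t ^ (d - k - 1))) fun A => ?_).trans ?_
  · refine measure_pi_sum_le _ (N := {b | Sum.elim A b ∈ N}) (hNm.preimage ?_) fun S => ?_
    · exact measurable_pi_iff.2 fun i => by cases i <;> simp <;> fun_prop
    obtain ⟨u, hu⟩ := exists_sphere_orthogonal (Sum.elim A S)
      (by simp only [Fintype.card_sum, Fintype.card_fin]; omega)
    refine (measure_mono fun T hT => ?_).trans (pi_stdGaussian_normal_le A u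
      (fun i => hu (.inl i)) (m := d - k - 1) (κ := Fin (d - k - 1))
      (by simp only [Fintype.card_fin]; omega) (by simp only [Fintype.card_fin]; omega) ht)
    rw [Set.mem_ofPred_eq]
    intro v hvA hvT
    exact sub_nonpos.1 (hT (u, v) ⟨⟨fun i => hu (.inl i), fun j => hu (.inr j)⟩, hvA, hvT⟩)
  · gcongr
    exact one_le_two
end

section
/- Let d ≥ 2 and suppose A₁, …, A_n are independent standard Gaussian random vectors in ℝ^d with n/(d−1) ≥ c₀ for some constant c₀ > 1. Define V = 𝒢( ( ⋃_{S ⊆ [n], |S| = d−1} span(A_S) )_ε ). Then there exist constants c₂, c₄ > 1, depending only on c₀, such that whenever ε ≤ 1/(c₄·c₂^{d−1}), with probability at least 1 − c₄·e^{−d} one has V ≥ c₂^{d−1}·ε/√(2π). -/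
open MeasureTheory ProbabilityTheory

section Geometry

variable {E : Type*} [NormedAddCommGroup E] [InnerProductSpace ℝ E]

theorem strip_subset_cthickening {p : Submodule ℝ E} {u : E} (hu : ‖u‖ = 1)
    (hp : p = (Submodule.span ℝ {u})ᗮ) (ε : ℝ) :
    {x | |inner ℝ u x| ≤ ε} ⊆ Metric.cthickening ε (p : Set E) := by
  intro x hx
  refine Metric.mem_cthickening_of_dist_le x (x - inner ℝ u x • u) ε _ ?_ ?_
  · rw [hp, SetLike.mem_coe, Submodule.mem_orthogonal_singleton_iff_inner_right, inner_sub_right,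
      inner_smul_right]
    simp [hu]
  · rw [dist_eq_norm, sub_sub_cancel, norm_smul, hu, mul_one, Real.norm_eq_abs]
    exact hx

theorem sum_inner_sq_le_of_net {ι : Type*} {A : ι → E} {I : Finset ι} {N : Finset E} {t : ℝ}
    (hN : ∀ x : E, ‖x‖ = 1 → ∃ y ∈ N, ‖x - y‖ ≤ 1 / 2)
    (ht : ∀ y ∈ N, ∑ i ∈ I, inner ℝ y (A i) ^ 2 ≤ t) (ht0 : 0 ≤ t) (w : E) :
    ∑ i ∈ I, inner ℝ w (A i) ^ 2 ≤ 4 * t * ‖w‖ ^ 2 := by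
  let L : E →L[ℝ] EuclideanSpace ℝ I :=
    (EuclideanSpace.equiv I ℝ).symm.toContinuousLinearMap ∘L
      ContinuousLinearMap.pi fun i : I => innerSL ℝ (A i)
  have hL : ∀ w, ‖L w‖ ^ 2 = ∑ i ∈ I, inner ℝ w (A i) ^ 2 := fun w => by
    rw [EuclideanSpace.norm_sq_eq, ← Finset.sum_coe_sort I]
    refine Finset.sum_congr rfl fun i _ => ?_
    simp [L, real_inner_comm]
  have hnet : ∀ y ∈ N, ‖L y‖ ≤ Real.sqrt t := fun y hy =>
    Real.le_sqrt_of_sq_le ((hL y).trans_le (ht y hy))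
  have hunit : ∀ x : E, ‖x‖ = 1 → ‖L x‖ ≤ Real.sqrt t + ‖L‖ / 2 := fun x hx => by
    obtain ⟨y, hy, hxy⟩ := hN x hx
    calc ‖L x‖ = ‖L y + L (x - y)‖ := by rw [map_sub]; congr 1; abel
      _ ≤ ‖L y‖ + ‖L (x - y)‖ := norm_add_le _ _
      _ ≤ Real.sqrt t + ‖L‖ * (1 / 2) :=
        add_le_add (hnet y hy) ((L.le_opNorm _).trans (by gcongr))
      _ = Real.sqrt t + ‖L‖ / 2 := by ring
  have hop : ‖L‖ ≤ Real.sqrt t + ‖L‖ / 2 := by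
    refine L.opNorm_le_bound (by positivity) fun x => ?_
    rcases eq_or_ne x 0 with rfl | hx
    · simp
    · have h := hunit (‖x‖⁻¹ • x) (by simp [norm_smul, hx])
      rw [map_smul, norm_smul, norm_inv, norm_norm, inv_mul_le_iff₀ (norm_pos_iff.2 hx)] at h
      linarith
  have hop' : ‖L‖ ≤ 2 * Real.sqrt t := by linarith
  rw [← hL]
  calc ‖L w‖ ^ 2 ≤ (2 * Real.sqrt t * ‖w‖) ^ 2 := by
        gcongr
        exact (L.le_opNorm w).trans (by gcongr)
    _ = 4 * t * ‖w‖ ^ 2 := by rw [mul_pow, mul_pow, Real.sq_sqrt ht0]; ring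

/-- If `v` is orthogonal to the `A i`, `i ∈ T`, while `u` is quantitatively not, then `u` and `v`
are quantitatively not parallel. -/
theorem mul_inner_sq_le {ι : Type*} {A : ι → E} {I T : Finset ι} (hTI : T ⊆ I) {C r : ℝ}
    (hC : ∀ w, ∑ i ∈ I, inner ℝ w (A i) ^ 2 ≤ C * ‖w‖ ^ 2) {u v : E} (hu : ‖u‖ = 1) (hv : ‖v‖ = 1)
    (hvT : ∀ i ∈ T, inner ℝ v (A i) = 0) (hr : r ≤ ∑ i ∈ T, inner ℝ u (A i) ^ 2) :
    r * inner ℝ u v ^ 2 ≤ C * (1 - inner ℝ u v ^ 2) := by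
  set a : ℝ := inner ℝ u v with ha
  set w : E := v - a • u with hw
  have hwn : ‖w‖ ^ 2 = 1 - a ^ 2 := by
    rw [hw, norm_sub_sq_real, norm_smul, hu, hv, inner_smul_right, real_inner_comm, ← ha]
    simp; ring
  calc r * a ^ 2 ≤ (∑ i ∈ T, inner ℝ u (A i) ^ 2) * a ^ 2 := by gcongr
    _ = ∑ i ∈ T, inner ℝ w (A i) ^ 2 := by
      rw [Finset.sum_mul]
      refine Finset.sum_congr rfl fun i hi => ?_
      rw [hw, inner_sub_left, hvT i hi, inner_smul_left]
      simp; ring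
    _ ≤ ∑ i ∈ I, inner ℝ w (A i) ^ 2 :=
      Finset.sum_le_sum_of_subset_of_nonneg hTI fun _ _ _ => sq_nonneg _
    _ ≤ C * (1 - a ^ 2) := hwn ▸ hC w

variable [FiniteDimensional ℝ E]

/-- Linearly independent vectors spanning codimension one have a unit normal spanning their
orthogonal complement. -/
theorem exists_unit_normal {ι : Type*} [Fintype ι] {a : ι → E} (ha : LinearIndependent ℝ a)
    (hι : Fintype.card ι + 1 = Module.finrank ℝ E) :
    ∃ u : E, ‖u‖ = 1 ∧ Submodule.span ℝ (Set.range a) = (Submodule.span ℝ {u})ᗮ := by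
  set p := Submodule.span ℝ (Set.range a) with hp
  have hpr : Module.finrank ℝ p = Fintype.card ι := finrank_span_eq_card ha
  have hpo : Module.finrank ℝ pᗮ = 1 := by
    have := p.finrank_add_finrank_orthogonal
    omega
  have hbot : pᗮ ≠ ⊥ := fun h => by rw [h, finrank_bot] at hpo; omega
  obtain ⟨v, hv, hv0⟩ := Submodule.exists_mem_ne_zero_of_ne_bot hbot
  have hu : ‖(‖v‖⁻¹ • v)‖ = 1 := by simp [norm_smul, hv0]
  refine ⟨‖v‖⁻¹ • v, hu, ?_⟩
  have hle : Submodule.span ℝ {‖v‖⁻¹ • v} ≤ pᗮ :=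
    (Submodule.span_singleton_le_iff_mem _ _).2 (Submodule.smul_mem _ _ hv)
  rw [Submodule.eq_of_le_of_finrank_eq hle ?_, Submodule.orthogonal_orthogonal]
  rw [hpo, finrank_span_singleton fun h => by simp [h] at hu]

theorem isClosed_exists_unit_normal {ι : Type*} [Fintype ι] (S T : Finset ι) (r : ℝ) :
    IsClosed {A : ι → E | ∃ u : E, ‖u‖ = 1 ∧ (∀ i ∈ S, inner ℝ u (A i) = 0) ∧
      ∑ i ∈ T, inner ℝ u (A i) ^ 2 ≤ r} := by
  have hC : IsClosed {q : (ι → E) × Metric.sphere (0 : E) 1 |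
      (∀ i ∈ S, inner ℝ (q.2 : E) (q.1 i) = 0) ∧ ∑ i ∈ T, inner ℝ (q.2 : E) (q.1 i) ^ 2 ≤ r} := by
    refine IsClosed.and ?_ ?_
    · simp only [Set.ofPred_forall]
      exact isClosed_biInter fun i _ => isClosed_eq (by fun_prop) continuous_const
    · exact isClosed_le (by fun_prop) continuous_const
  convert isClosedMap_fst_of_compactSpace _ hC using 1
  ext A
  simp [and_left_comm]

variable (E) in
theorem exists_half_net_sphere : ∃ N : Finset E, N.card ≤ 5 ^ Module.finrank ℝ E ∧
    (∀ y ∈ N, ‖y‖ = 1) ∧ ∀ x : E, ‖x‖ = 1 → ∃ y ∈ N, ‖x - y‖ ≤ 1 / 2 := by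
  classical
  let P : Finset E → Prop := fun N => (∀ y ∈ N, ‖y‖ = 2) ∧
    ∀ y ∈ N, ∀ z ∈ N, y ≠ z → 1 ≤ ‖y - z‖
  have hP : ∀ N, P N → N.card ≤ 5 ^ Module.finrank ℝ E := fun N hN =>
    Besicovitch.card_le_of_separated N (fun c hc => (hN.1 c hc).le) hN.2
  have hne : {k | ∃ N, P N ∧ N.card = k}.Nonempty := ⟨0, ∅, by simp [P], by simp⟩
  have hbdd : BddAbove {k | ∃ N, P N ∧ N.card = k} :=
    ⟨5 ^ Module.finrank ℝ E, by rintro _ ⟨N, hN, rfl⟩; exact hP N hN⟩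
  obtain ⟨N, hN, hcard⟩ := Nat.sSup_mem hne hbdd
  refine ⟨N.image fun y => (1 / 2 : ℝ) • y, Finset.card_image_le.trans (hP N hN), ?_, ?_⟩
  · intro y hy
    obtain ⟨z, hz, rfl⟩ := Finset.mem_image.1 hy
    rw [norm_smul, hN.1 z hz]
    norm_num
  · intro x hx
    have hx2 : ‖(2 : ℝ) • x‖ = 2 := by rw [norm_smul, hx]; norm_num
    obtain ⟨y, hy, hxy⟩ : ∃ y ∈ N, ‖(2 : ℝ) • x - y‖ ≤ 1 := by
      by_contra! hcon
      have hnot : (2 : ℝ) • x ∉ N := fun h => by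
        have := hcon _ h
        rw [sub_self, norm_zero] at this
        linarith
      have hins : P (insert ((2 : ℝ) • x) N) := by
        refine ⟨?_, ?_⟩
        · intro y hy
          rcases Finset.mem_insert.1 hy with rfl | hy
          · exact hx2
          · exact hN.1 y hy
        · intro y hy z hz hyz
          rcases Finset.mem_insert.1 hy with rfl | hy <;> rcases Finset.mem_insert.1 hz with rfl | hz
          · exact absurd rfl hyz
          · exact (hcon z hz).le
          · rw [norm_sub_rev]; exact (hcon y hy).le
          · exact hN.2 y hy z hz hyz
      have := le_csSup hbdd ⟨_, hins, rfl⟩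
      rw [Finset.card_insert_of_notMem hnot] at this
      omega
    refine ⟨(1 / 2 : ℝ) • y, Finset.mem_image_of_mem _ hy, ?_⟩
    have : x - (1 / 2 : ℝ) • y = (1 / 2 : ℝ) • ((2 : ℝ) • x - y) := by
      rw [smul_sub, smul_smul]; norm_num
    rw [this, norm_smul]
    norm_num
    linarith

end Geometry

section Gaussian

theorem gaussianReal_Icc_le {t : ℝ} (ht : 0 ≤ t) :
    gaussianReal 0 1 (Set.Icc (-t) t) ≤ ENNReal.ofReal t := by
  rw [gaussianReal_apply_eq_integral 0 one_ne_zero]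
  refine ENNReal.ofReal_le_ofReal ?_
  have hsqrt : 2 ≤ Real.sqrt (2 * Real.pi) :=
    Real.le_sqrt_of_sq_le (by nlinarith [Real.pi_gt_three])
  have hpdf : ∀ x, gaussianPDFReal 0 1 x ≤ 1 / 2 := fun x => by
    simp only [gaussianPDFReal, NNReal.coe_one, mul_one, sub_zero]
    calc (Real.sqrt (2 * Real.pi))⁻¹ * Real.exp (-x ^ 2 / 2)
        ≤ (2 : ℝ)⁻¹ * 1 := by
          gcongr
          exact Real.exp_le_one_iff.2 (by nlinarith [sq_nonneg x])
      _ = 1 / 2 := by norm_num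
  calc ∫ x in Set.Icc (-t) t, gaussianPDFReal 0 1 x
      ≤ ∫ _ in Set.Icc (-t) t, (1 / 2 : ℝ) :=
        setIntegral_mono (integrable_gaussianPDFReal 0 1).integrableOn
          (integrableOn_const (by simp)) hpdf
    _ = t := by
        rw [setIntegral_const, Measure.real, Real.volume_Icc,
          ENNReal.toReal_ofReal (by linarith), smul_eq_mul]
        ring

theorem le_gaussianReal_Icc {t : ℝ} (ht : 0 ≤ t) (ht' : t ≤ 1 / 2) :
    ENNReal.ofReal (3 / 2 * t / Real.sqrt (2 * Real.pi)) ≤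
      gaussianReal 0 1 (Set.Icc (-t) t) := by
  rw [gaussianReal_apply_eq_integral 0 one_ne_zero]
  refine ENNReal.ofReal_le_ofReal ?_
  have hpdf : ∀ x ∈ Set.Icc (-t) t,
      (Real.sqrt (2 * Real.pi))⁻¹ * (3 / 4) ≤ gaussianPDFReal 0 1 x := fun x hx => by
    simp only [gaussianPDFReal, NNReal.coe_one, mul_one, sub_zero]
    gcongr
    nlinarith [Real.add_one_le_exp (-x ^ 2 / 2), hx.1, hx.2]
  calc 3 / 2 * t / Real.sqrt (2 * Real.pi)
      = ∫ _ in Set.Icc (-t) t, (Real.sqrt (2 * Real.pi))⁻¹ * (3 / 4) := by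
        rw [setIntegral_const, Measure.real, Real.volume_Icc,
          ENNReal.toReal_ofReal (by linarith), smul_eq_mul]
        ring
    _ ≤ ∫ x in Set.Icc (-t) t, gaussianPDFReal 0 1 x :=
        setIntegral_mono_on (integrableOn_const (by simp))
          (integrable_gaussianPDFReal 0 1).integrableOn measurableSet_Icc hpdf

theorem lintegral_exp_mul_sq_gaussianReal {a : ℝ} (ha : a < 1 / 2) :
    ∫⁻ x, ENNReal.ofReal (Real.exp (a * x ^ 2)) ∂gaussianReal 0 1 =
      ENNReal.ofReal (Real.sqrt (1 - 2 * a))⁻¹ := by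
  have hb : 0 < 1 / 2 - a := by linarith
  have hintegrable := (integrable_exp_neg_mul_sq hb).const_mul (Real.sqrt (2 * Real.pi))⁻¹
  rw [gaussianReal_of_var_ne_zero 0 one_ne_zero,
    lintegral_withDensity_eq_lintegral_mul _ (measurable_gaussianPDF 0 1) (by fun_prop)]
  have hprod : ∀ x : ℝ, (gaussianPDF 0 1 * fun x => ENNReal.ofReal (Real.exp (a * x ^ 2))) x =
      ENNReal.ofReal ((Real.sqrt (2 * Real.pi))⁻¹ * Real.exp (-(1 / 2 - a) * x ^ 2)) := fun x => by
    rw [Pi.mul_apply, gaussianPDF, ← ENNReal.ofReal_mul (gaussianPDFReal_nonneg _ _ _)]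
    simp only [gaussianPDFReal, NNReal.coe_one, mul_one, sub_zero]
    rw [mul_assoc, ← Real.exp_add]
    ring_nf
  simp_rw [hprod]
  rw [← ofReal_integral_eq_lintegral_ofReal hintegrable (ae_of_all _ fun x => by positivity),
    integral_const_mul, integral_gaussian]
  congr 1
  rw [← Real.sqrt_inv, ← Real.sqrt_inv, ← Real.sqrt_mul (by positivity)]
  congr 1
  have : 1 - 2 * a ≠ 0 := by linarith
  field_simp

variable {E : Type*} [NormedAddCommGroup E] [InnerProductSpace ℝ E] [FiniteDimensional ℝ E]
  [MeasurableSpace E] [BorelSpace E]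

theorem map_inner_stdGaussian {u : E} (hu : ‖u‖ = 1) :
    (ProbabilityTheory.stdGaussian E).map (fun x => inner ℝ u x) = gaussianReal 0 1 := by
  have h := IsGaussian.map_eq_gaussianReal (μ := ProbabilityTheory.stdGaussian E) (innerSL ℝ u)
  rw [integral_strongDual_stdGaussian, variance_dual_stdGaussian, innerSL_apply_norm, hu] at h
  simpa using h

theorem stdGaussian_strip {u : E} (hu : ‖u‖ = 1) (t : ℝ) :
    ProbabilityTheory.stdGaussian E {x | |inner ℝ u x| ≤ t} =
      gaussianReal 0 1 (Set.Icc (-t) t) := by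
  rw [← map_inner_stdGaussian hu, Measure.map_apply (by fun_prop) measurableSet_Icc]
  simp [Set.preimage, abs_le]

theorem indepFun_inner_stdGaussian {u w : E} (h : inner ℝ u w = 0) :
    IndepFun (fun x : E => inner ℝ u x) (fun x => inner ℝ w x)
      (ProbabilityTheory.stdGaussian E) := by
  refine HasGaussianLaw.indepFun_of_covariance_eq_zero ?_ ?_
  · have := IsGaussian.hasGaussianLaw_id (μ := ProbabilityTheory.stdGaussian E)
    exact this.map_fun ((innerSL ℝ u).prod (innerSL ℝ w))
  · rw [← covarianceBilin_apply_eq_cov (IsGaussian.memLp_two_id), covarianceBilin_stdGaussian]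
    exact h

/-- Two bands whose unit normals meet at an angle of sine at least `s` have intersection of
Gaussian measure of second order in their width. -/
theorem stdGaussian_strip_inter_le {u v : E} (hu : ‖u‖ = 1) (hv : ‖v‖ = 1) {s ε : ℝ} (hs : 0 < s)
    (hε : 0 ≤ ε) (huv : s ^ 2 ≤ 1 - inner ℝ u v ^ 2) :
    ProbabilityTheory.stdGaussian E ({x | |inner ℝ u x| ≤ ε} ∩ {x | |inner ℝ v x| ≤ ε}) ≤
      ENNReal.ofReal (ε * (2 * ε / s)) := by
  set a : ℝ := inner ℝ u v with ha
  set w : E := v - a • u with hw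
  have huu : inner ℝ u u = (1 : ℝ) := by simp [hu]
  have huw : inner ℝ u w = (0 : ℝ) := by
    rw [hw, inner_sub_right, inner_smul_right, huu]; simp [ha]
  have hwn : ‖w‖ ^ 2 = 1 - a ^ 2 := by
    rw [hw, norm_sub_sq_real, norm_smul, hu, hv, inner_smul_right, real_inner_comm, ← ha]
    simp; ring
  have hsw : s ≤ ‖w‖ := by
    refine le_of_sq_le_sq ?_ (norm_nonneg _)
    rwa [hwn]
  have hw0 : 0 < ‖w‖ := hs.trans_le hsw
  set e : E := ‖w‖⁻¹ • w with he
  have hen : ‖e‖ = 1 := by rw [he, norm_smul]; simp [hw0.ne']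
  have hue : inner ℝ u e = (0 : ℝ) := by rw [he, inner_smul_right, huw, mul_zero]
  have ha1 : |a| ≤ 1 := by simpa [hu, hv] using abs_real_inner_le_norm u v
  have hsub : ({x : E | |inner ℝ u x| ≤ ε} ∩ {x | |inner ℝ v x| ≤ ε}) ⊆
      (fun x => inner ℝ u x) ⁻¹' Set.Icc (-ε) ε ∩
        (fun x => inner ℝ e x) ⁻¹' Set.Icc (-(2 * ε / s)) (2 * ε / s) := by
    rintro x ⟨hx, hy⟩
    simp only [Set.mem_ofPred_eq] at hx hy
    refine ⟨abs_le.1 hx, abs_le.1 ?_⟩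
    have h1 : inner ℝ w x = inner ℝ v x - a * inner ℝ u x := by
      rw [hw, inner_sub_left, inner_smul_left]; simp
    have h2 : |inner ℝ w x| ≤ 2 * ε := by
      rw [h1]
      calc |inner ℝ v x - a * inner ℝ u x| ≤ |inner ℝ v x| + |a * inner ℝ u x| := abs_sub _ _
        _ ≤ ε + 1 * ε := by rw [abs_mul]; gcongr
        _ = 2 * ε := by ring
    change |inner ℝ e x| ≤ 2 * ε / s
    rw [he, inner_smul_left, abs_mul]
    simp only [map_inv₀, conj_trivial, abs_inv, abs_norm]
    rw [inv_mul_eq_div]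
    gcongr
  refine (measure_mono hsub).trans ?_
  rw [(indepFun_inner_stdGaussian hue).measure_inter_preimage_eq_mul _ _ measurableSet_Icc
      measurableSet_Icc, ENNReal.ofReal_mul hε,
    ← Measure.map_apply (by fun_prop) measurableSet_Icc,
    ← Measure.map_apply (by fun_prop) measurableSet_Icc, map_inner_stdGaussian hu,
    map_inner_stdGaussian hen]
  gcongr
  · exact gaussianReal_Icc_le hε
  · exact gaussianReal_Icc_le (by positivity)

theorem lintegral_exp_sum_inner_sq {ι : Type*} [Fintype ι] (s : Finset ι) {u : E} (hu : ‖u‖ = 1)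
    {a : ℝ} (ha : a < 1 / 2) :
    ∫⁻ A, ENNReal.ofReal (Real.exp (a * ∑ i ∈ s, inner ℝ u (A i) ^ 2))
        ∂(Measure.pi fun _ : ι => ProbabilityTheory.stdGaussian E) =
      ENNReal.ofReal (Real.sqrt (1 - 2 * a))⁻¹ ^ s.card := by
  have hexp : ∀ A : ι → E, ENNReal.ofReal (Real.exp (a * ∑ i ∈ s, inner ℝ u (A i) ^ 2)) =
      ∏ i ∈ s, ENNReal.ofReal (Real.exp (a * inner ℝ u (A i) ^ 2)) := fun A => by
    rw [Finset.mul_sum, Real.exp_sum, ENNReal.ofReal_prod_of_nonneg fun _ _ => (Real.exp_pos _).le]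
  simp_rw [hexp]
  rw [lintegral_prod_eq_prod_lintegral_of_indepFun s
    (fun i (A : ι → E) => ENNReal.ofReal (Real.exp (a * inner ℝ u (A i) ^ 2)))
    (iIndepFun_pi (X := fun _ x => ENNReal.ofReal (Real.exp (a * inner ℝ u x ^ 2)))
      fun i => by fun_prop) (fun i => by fun_prop), ← Finset.prod_const]
  refine Finset.prod_congr rfl fun i _ => ?_
  rw [← lintegral_exp_mul_sq_gaussianReal ha, ← map_inner_stdGaussian hu,
    lintegral_map (by fun_prop) (by fun_prop)]
  exact (measurePreserving_eval (fun _ : ι => ProbabilityTheory.stdGaussian E) i).lintegral_comp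
    (f := fun x => ENNReal.ofReal (Real.exp (a * inner ℝ u x ^ 2))) (by fun_prop)

/-- Chernoff bound for `∑ ⟪u, A i⟫ ^ 2`, covering both tails through the sign of `a`. -/
theorem measure_sum_inner_sq_le {ι : Type*} [Fintype ι] (s : Finset ι) {u : E} (hu : ‖u‖ = 1)
    {a : ℝ} (ha : a < 1 / 2) (r : ℝ) :
    (Measure.pi fun _ : ι => ProbabilityTheory.stdGaussian E)
        {A | a * r ≤ a * ∑ i ∈ s, inner ℝ u (A i) ^ 2} ≤
      ENNReal.ofReal (Real.exp (-(a * r)) * (Real.sqrt (1 - 2 * a))⁻¹ ^ s.card) := by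
  have h := mul_meas_ge_le_lintegral
    (μ := Measure.pi fun _ : ι => ProbabilityTheory.stdGaussian E)
    (f := fun A => ENNReal.ofReal (Real.exp (a * ∑ i ∈ s, inner ℝ u (A i) ^ 2)))
    (by fun_prop) (ENNReal.ofReal (Real.exp (a * r)))
  rw [lintegral_exp_sum_inner_sq s hu ha] at h
  simp only [ENNReal.ofReal_le_ofReal_iff (Real.exp_pos _).le, Real.exp_le_exp] at h
  rw [ENNReal.ofReal_mul (Real.exp_pos _).le, ENNReal.ofReal_pow (by positivity), Real.exp_neg,
    ENNReal.ofReal_inv_of_pos (Real.exp_pos _), ← ENNReal.div_eq_inv_mul,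
    ENNReal.le_div_iff_mul_le (by simp [Real.exp_pos]) (by simp), mul_comm]
  exact h


theorem stdGaussian_submodule {p : Submodule ℝ E} (hp : p ≠ ⊤) :
    ProbabilityTheory.stdGaussian E (p : Set E) = 0 := by
  obtain ⟨v, hv, hv0⟩ := Submodule.exists_mem_ne_zero_of_ne_bot
    (mt Submodule.orthogonal_eq_bot_iff.1 hp)
  have hu : ‖(‖v‖⁻¹ • v)‖ = 1 := by simp [norm_smul, hv0]
  refine measure_mono_null (t := {x | |inner ℝ (‖v‖⁻¹ • v) x| ≤ 0}) (fun x hx => ?_) ?_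
  · simp only [Set.mem_ofPred_eq, inner_smul_left]
    rw [Submodule.inner_left_of_mem_orthogonal hx hv]
    simp
  · rw [stdGaussian_strip hu, ← nonpos_iff_eq_zero]
    simpa using gaussianReal_Icc_le le_rfl

theorem ae_linearIndependent_fin {k : ℕ} (hk : k ≤ Module.finrank ℝ E) :
    ∀ᵐ A ∂(Measure.pi fun _ : Fin k => ProbabilityTheory.stdGaussian E),
      LinearIndependent ℝ A := by
  induction k with
  | zero => exact ae_of_all _ fun A => linearIndependent_empty_type
  | succ k ih =>
    have he := Measure.measurePreserving_swap.comp (measurePreserving_piFinSuccAbove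
      (fun _ : Fin (k + 1) => ProbabilityTheory.stdGaussian E) 0)
    have hmeas : MeasurableSet {q : (Fin k → E) × E | LinearIndependent ℝ (Fin.cons q.2 q.1 :
        Fin (k + 1) → E)} := by
      refine (isOpen_setOfPred_linearIndependent (𝕜 := ℝ) (E := E)).measurableSet.preimage
        (f := fun q : (Fin k → E) × E => (Fin.cons q.2 q.1 : Fin (k + 1) → E)) ?_
      refine measurable_pi_iff.2 fun i => ?_
      refine Fin.cases ?_ (fun j => ?_) i
      · simpa using measurable_snd
      · simp only [Fin.cons_succ]
        fun_prop
    have hprod : ∀ᵐ q ∂((Measure.pi fun _ : Fin k => ProbabilityTheory.stdGaussian E).prod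
        (ProbabilityTheory.stdGaussian E)),
        LinearIndependent ℝ (Fin.cons q.2 q.1 : Fin (k + 1) → E) := by
      refine (Measure.ae_prod_iff_ae_ae hmeas).2 ?_
      filter_upwards [ih (by omega)] with v hv
      have hne : Submodule.span ℝ (Set.range v) ≠ ⊤ := fun htop => by
        have := finrank_range_le_card (R := ℝ) v
        rw [Set.finrank, htop, finrank_top, Fintype.card_fin] at this
        omega
      filter_upwards [measure_eq_zero_iff_ae_notMem.1 (stdGaussian_submodule hne)] with x hx
      exact linearIndependent_finCons.2 ⟨hv, hx⟩
    filter_upwards [he.quasiMeasurePreserving.ae hprod] with A hA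
    convert hA using 1
    exact (Fin.cons_self_tail A).symm

theorem ae_linearIndependent {ι : Type*} [Fintype ι] (hι : Fintype.card ι ≤ Module.finrank ℝ E) :
    ∀ᵐ A ∂(Measure.pi fun _ : ι => ProbabilityTheory.stdGaussian E), LinearIndependent ℝ A := by
  have he := measurePreserving_piCongrLeft
    (fun _ : Fin (Fintype.card ι) => ProbabilityTheory.stdGaussian E) (Fintype.equivFin ι)
  filter_upwards [he.quasiMeasurePreserving.ae (ae_linearIndependent_fin hι)] with A hA
  refine (linearIndependent_equiv' (Fintype.equivFin ι) ?_).2 hA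
  ext i
  simp [MeasurableEquiv.coe_piCongrLeft, Equiv.piCongrLeft_apply_apply]

theorem ae_linearIndependent_finset {ι : Type*} [Fintype ι] [DecidableEq ι] (S : Finset ι)
    (hS : S.card ≤ Module.finrank ℝ E) :
    ∀ᵐ A ∂(Measure.pi fun _ : ι => ProbabilityTheory.stdGaussian E),
      LinearIndependent ℝ fun i : {i // i ∈ S} => A i := by
  let : Fintype {i // i ∈ S} := Subtype.fintype _
  have he := measurePreserving_fst.comp (measurePreserving_piEquivPiSubtypeProd
    (fun _ : ι => ProbabilityTheory.stdGaussian E) (fun i => i ∈ S))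
  exact he.quasiMeasurePreserving.ae (ae_linearIndependent
    ((Fintype.card_of_subtype S fun _ => Iff.rfl).trans_le hS))

/-- It is unlikely that the normal to the span of `A i`, `i ∈ S`, is nearly orthogonal to all the
independent vectors `A i`, `i ∈ T`. -/
theorem measure_exists_unit_normal_le {ι : Type*} [Fintype ι] [DecidableEq ι] {S T : Finset ι}
    (hST : Disjoint S T) (hS : S.card + 1 = Module.finrank ℝ E) {a : ℝ} (ha : 0 < a) (r : ℝ) :
    (Measure.pi fun _ : ι => ProbabilityTheory.stdGaussian E)
        {A | ∃ u : E, ‖u‖ = 1 ∧ (∀ i ∈ S, inner ℝ u (A i) = 0) ∧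
          ∑ i ∈ T, inner ℝ u (A i) ^ 2 ≤ r} ≤
      ENNReal.ofReal (Real.exp (a * r) * (Real.sqrt (1 + 2 * a))⁻¹ ^ T.card) := by
  set B := {A : ι → E | ∃ u : E, ‖u‖ = 1 ∧ (∀ i ∈ S, inner ℝ u (A i) = 0) ∧
    ∑ i ∈ T, inner ℝ u (A i) ^ 2 ≤ r} with hB
  have hBm : MeasurableSet B := (isClosed_exists_unit_normal S T r).measurableSet
  have he := (measurePreserving_piEquivPiSubtypeProd
    (fun _ : ι => ProbabilityTheory.stdGaussian E) (fun i => i ∈ S)).symm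
  rw [← he.measure_preimage hBm.nullMeasurableSet, Measure.prod_apply (he.measurable hBm)]
  refine (lintegral_mono_ae (g := fun _ => ENNReal.ofReal
    (Real.exp (a * r) * (Real.sqrt (1 + 2 * a))⁻¹ ^ T.card)) ?_).trans (by simp)
  let : Fintype {i // i ∈ S} := Subtype.fintype _
  have hcard : Fintype.card {i // i ∈ S} = S.card := Fintype.card_of_subtype S fun _ => Iff.rfl
  filter_upwards [ae_linearIndependent (E := E) (ι := {i // i ∈ S}) (by omega)] with x hx
  obtain ⟨u, hu, hspan⟩ := exists_unit_normal hx (by omega)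
  let T' : Finset {i // ¬ i ∈ S} := T.subtype _
  have hT' : T'.card = T.card := by
    rw [Finset.card_subtype, Finset.filter_true_of_mem]
    exact fun i hi hiS => Finset.disjoint_left.1 hST hiS hi
  have hch := measure_sum_inner_sq_le (E := E) T' hu (a := -a) (by linarith) r
  rw [hT'] at hch
  simp only [neg_mul, neg_neg, mul_neg, sub_neg_eq_add] at hch
  refine le_trans (measure_mono fun y hy => ?_) hch
  obtain ⟨v, hv, hvS, hvT⟩ := hy
  have hvspan : v ∈ Submodule.span ℝ {u} := by
    rw [← Submodule.orthogonal_orthogonal (Submodule.span ℝ {u}), ← hspan]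
    refine (Submodule.mem_orthogonal' _ _).2 fun z hz => ?_
    induction hz using Submodule.span_induction with
    | mem z hz =>
      obtain ⟨i, rfl⟩ := hz
      simpa [MeasurableEquiv.piEquivPiSubtypeProd, Equiv.piEquivPiSubtypeProd] using hvS i i.2
    | zero => simp
    | add y z _ _ hy hz => rw [inner_add_right, hy, hz, add_zero]
    | smul c z _ hz => rw [inner_smul_right, hz, mul_zero]
  obtain ⟨c, rfl⟩ := Submodule.mem_span_singleton.1 hvspan
  have hc : c ^ 2 = 1 := by
    rw [norm_smul, hu, mul_one] at hv
    rw [← sq_abs, ← Real.norm_eq_abs, hv, one_pow]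
  have hsum : ∑ i ∈ T', inner ℝ u (y i) ^ 2 ≤ r := by
    refine le_trans (le_of_eq ?_) hvT
    rw [← Finset.sum_subtype_of_mem (p := fun i => ¬ i ∈ S) _
      fun i hi hiS => Finset.disjoint_left.1 hST hiS hi]
    refine Finset.sum_congr rfl fun i _ => ?_
    simp [MeasurableEquiv.piEquivPiSubtypeProd, Equiv.piEquivPiSubtypeProd, i.2,
      inner_smul_left, mul_pow, hc]
  simp only [Set.mem_ofPred_eq, neg_le_neg_iff]
  gcongr

/-- A Gaussian matrix with at most `2 d` rows of length `d` has operator norm at most `8 √d`, except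
with probability `exp (-d)`. -/
theorem measure_sum_inner_sq_gt_le {ι : Type*} [Fintype ι] (I : Finset ι)
    (hI : I.card ≤ 2 * Module.finrank ℝ E) :
    (Measure.pi fun _ : ι => ProbabilityTheory.stdGaussian E)
        {A | ¬ ∀ w : E, ∑ i ∈ I, inner ℝ w (A i) ^ 2 ≤ 64 * Module.finrank ℝ E * ‖w‖ ^ 2} ≤
      ENNReal.ofReal (Real.exp (-(Module.finrank ℝ E))) := by
  set d := Module.finrank ℝ E
  obtain ⟨N, hNcard, hN1, hN⟩ := exists_half_net_sphere E
  have hsub : {A : ι → E | ¬ ∀ w : E, ∑ i ∈ I, inner ℝ w (A i) ^ 2 ≤ 64 * d * ‖w‖ ^ 2} ⊆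
      ⋃ y ∈ N, {A | 1 / 4 * (16 * d : ℝ) ≤ 1 / 4 * ∑ i ∈ I, inner ℝ y (A i) ^ 2} := by
    intro A hA
    by_contra hcon
    simp only [Set.mem_iUnion, Set.mem_ofPred_eq, not_exists, not_le] at hcon
    refine hA fun w => ?_
    refine (sum_inner_sq_le_of_net hN (t := 16 * d) (fun y hy => ?_) (by positivity) w).trans
      (le_of_eq (by ring))
    linarith [hcon y hy]
  have hsqrt : ((Real.sqrt (1 - 2 * (1 / 4)))⁻¹) ^ I.card ≤ (2 : ℝ) ^ d := by
    have h1 : (Real.sqrt (1 - 2 * (1 / 4)))⁻¹ = Real.sqrt 2 := by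
      rw [← Real.sqrt_inv]; norm_num
    rw [h1]
    calc Real.sqrt 2 ^ I.card ≤ Real.sqrt 2 ^ (2 * d) :=
          pow_le_pow_right₀ (Real.one_le_sqrt.2 (by norm_num)) hI
      _ = 2 ^ d := by rw [pow_mul, Real.sq_sqrt (by norm_num)]
  calc _ ≤ ∑ y ∈ N, (Measure.pi fun _ : ι => ProbabilityTheory.stdGaussian E)
          {A | 1 / 4 * (16 * d : ℝ) ≤ 1 / 4 * ∑ i ∈ I, inner ℝ y (A i) ^ 2} :=
        (measure_mono hsub).trans (measure_biUnion_finset_le _ _)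
    _ ≤ ∑ y ∈ N, ENNReal.ofReal (Real.exp (-(4 * d)) * 2 ^ d) := by
        refine Finset.sum_le_sum fun y hy => ?_
        refine (measure_sum_inner_sq_le I (hN1 y hy) (by norm_num) _).trans
          (ENNReal.ofReal_le_ofReal ?_)
        rw [show -(1 / 4 * (16 * (d : ℝ))) = -(4 * d) by ring]
        gcongr
    _ = ENNReal.ofReal (N.card * (Real.exp (-(4 * d)) * 2 ^ d)) := by
        rw [Finset.sum_const, nsmul_eq_mul, ENNReal.ofReal_mul (p := (N.card : ℝ)) (by positivity),
          ENNReal.ofReal_natCast]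
    _ ≤ ENNReal.ofReal (Real.exp (-d)) := by
        refine ENNReal.ofReal_le_ofReal ?_
        have h10 : (10 : ℝ) ≤ Real.exp 3 := by
          have := Real.exp_one_gt_d9
          rw [show (3 : ℝ) = 1 + 1 + 1 by norm_num, Real.exp_add, Real.exp_add]
          nlinarith [mul_self_nonneg (Real.exp 1 - 2.7)]
        calc (N.card : ℝ) * (Real.exp (-(4 * d)) * 2 ^ d)
            ≤ 5 ^ d * (Real.exp (-(4 * d)) * 2 ^ d) := by
              gcongr
              exact_mod_cast hNcard
          _ = Real.exp (-(4 * d)) * 10 ^ d := by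
              rw [show (10 : ℝ) = 5 * 2 by norm_num, mul_pow]; ring
          _ ≤ Real.exp (-(4 * d)) * Real.exp 3 ^ d := by gcongr
          _ = Real.exp (-d) := by rw [← Real.exp_nat_mul, ← Real.exp_add]; ring_nf

end Gaussian

/-- A lower bound for the measure of a union from the measures of pairwise intersections. -/
theorem card_mul_sub_le_measure_biUnion {Ω ι : Type*} [MeasurableSpace Ω] (μ : Measure Ω)
    [IsFiniteMeasure μ] (F : Finset ι) {B : ι → Set Ω} (hB : ∀ i ∈ F, MeasurableSet (B i))
    {p q : ENNReal} (hp : ∀ i ∈ F, p ≤ μ (B i))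
    (hq : ∀ i ∈ F, ∀ j ∈ F, i ≠ j → μ (B i ∩ B j) ≤ q) :
    F.card * (p - F.card * q) ≤ μ (⋃ i ∈ F, B i) := by
  classical
  let D : ι → Set Ω := fun i => B i \ ⋃ j ∈ F.erase i, B j
  have hDm : ∀ i ∈ F, MeasurableSet (D i) := fun i hi =>
    (hB i hi).diff (Finset.measurableSet_biUnion _ fun j hj => hB j (Finset.mem_of_mem_erase hj))
  have hdisj : (F : Set ι).PairwiseDisjoint D := by
    intro i hi j hj hij
    refine Set.disjoint_left.2 fun x hx hx' => hx.2 ?_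
    exact Set.mem_biUnion (Finset.mem_erase.2 ⟨hij.symm, hj⟩) hx'.1
  have hD : ∀ i ∈ F, p - F.card * q ≤ μ (D i) := by
    intro i hi
    refine tsub_le_iff_right.2 ((hp i hi).trans ?_)
    have hcover : B i ⊆ D i ∪ ⋃ j ∈ F.erase i, (B i ∩ B j) := by
      intro x hx
      by_cases h : x ∈ ⋃ j ∈ F.erase i, B j
      · right
        simp only [Set.mem_iUnion] at h ⊢
        obtain ⟨j, hj, hxj⟩ := h
        exact ⟨j, hj, hx, hxj⟩
      · exact Or.inl ⟨hx, h⟩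
    refine (measure_mono hcover).trans ((measure_union_le _ _).trans ?_)
    gcongr
    refine (measure_biUnion_finset_le _ _).trans ?_
    calc ∑ j ∈ F.erase i, μ (B i ∩ B j) ≤ ∑ _j ∈ F.erase i, q := by
          refine Finset.sum_le_sum fun j hj => hq i hi j (Finset.mem_of_mem_erase hj) ?_
          exact (Finset.ne_of_mem_erase hj).symm
      _ ≤ F.card * q := by
          rw [Finset.sum_const, nsmul_eq_mul]
          gcongr
          exact Finset.erase_subset _ _
  calc (F.card : ENNReal) * (p - F.card * q) = ∑ _i ∈ F, (p - F.card * q) := by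
        rw [Finset.sum_const, nsmul_eq_mul]
    _ ≤ ∑ i ∈ F, μ (D i) := Finset.sum_le_sum hD
    _ = μ (⋃ i ∈ F, D i) := (measure_biUnion_finset hdisj hDm).symm
    _ ≤ μ (⋃ i ∈ F, B i) := measure_mono (Set.iUnion₂_mono fun i _ => Set.sdiff_subset)

section Code

/-- A binary code of exponential size with linear minimum distance. -/
theorem exists_binary_code (k : ℕ) : ∃ 𝒞 : Finset (Finset (Fin k)),
    (11 / 10 : ℝ) ^ k ≤ 𝒞.card ∧
      ∀ B ∈ 𝒞, ∀ B' ∈ 𝒞, B ≠ B' → k ≤ 4 * (symmDiff B B').card := by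
  obtain ⟨𝒞, h𝒞, hmax⟩ := Finset.exists_maximal
    (s := (Finset.univ : Finset (Finset (Finset (Fin k)))).filter fun 𝒞 =>
      ∀ B ∈ 𝒞, ∀ B' ∈ 𝒞, B ≠ B' → k ≤ 4 * (symmDiff B B').card) ⟨∅, by simp⟩
  rw [Finset.mem_filter] at h𝒞
  refine ⟨𝒞, ?_, h𝒞.2⟩
  let W : Finset (Finset (Fin k)) := Finset.univ.filter fun D => D = ∅ ∨ 4 * D.card < k
  have hcover : ∀ B : Finset (Fin k), ∃ C ∈ 𝒞, symmDiff B C ∈ W := by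
    intro B
    by_contra! hcon
    simp only [W, Finset.mem_filter, Finset.mem_univ, true_and, not_or, not_lt] at hcon
    have hmem : B ∈ 𝒞 := by
      refine hmax (y := insert B 𝒞) ?_ (Finset.subset_insert _ _) (Finset.mem_insert_self _ _)
      refine Finset.mem_filter.2 ⟨Finset.mem_univ _, fun D hD D' hD' hne => ?_⟩
      rcases Finset.mem_insert.1 hD with rfl | hDC <;>
        rcases Finset.mem_insert.1 hD' with rfl | hDC'
      · exact absurd rfl hne
      · exact (hcon _ hDC').2
      · rw [symmDiff_comm]; exact (hcon _ hDC).2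
      · exact h𝒞.2 _ hDC _ hDC' hne
    exact (hcon B hmem).1 (by simp)
  have hcount : 2 ^ k ≤ 𝒞.card * W.card := by
    calc 2 ^ k = (Finset.univ : Finset (Finset (Fin k))).card := by simp
      _ ≤ ((𝒞 ×ˢ W).image fun q => symmDiff q.2 q.1).card := by
        refine Finset.card_le_card fun B _ => ?_
        obtain ⟨C, hC, hW⟩ := hcover B
        exact Finset.mem_image.2 ⟨(C, symmDiff B C), Finset.mem_product.2 ⟨hC, hW⟩, by simp⟩
      _ ≤ 𝒞.card * W.card := Finset.card_image_le.trans (Finset.card_product _ _).le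
  have hW : (W.card : ℝ) ≤ (89 / 50) ^ k := by
    calc (W.card : ℝ) = ∑ _D ∈ W, (1 : ℝ) := by simp
      _ ≤ ∑ D ∈ W, (6 / 5 : ℝ) ^ k * (625 / 1296) ^ D.card := by
        refine Finset.sum_le_sum fun D hD => ?_
        have hle : 4 * D.card ≤ k := by
          rcases (Finset.mem_filter.1 hD).2 with rfl | h
          · simp
          · exact h.le
        rw [show (625 / 1296 : ℝ) = ((6 / 5) ^ 4)⁻¹ by norm_num, inv_pow, ← pow_mul,
          ← div_eq_mul_inv, one_le_div (by positivity)]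
        exact pow_le_pow_right₀ (by norm_num) hle
      _ ≤ ∑ D : Finset (Fin k), (6 / 5 : ℝ) ^ k * (625 / 1296) ^ D.card :=
        Finset.sum_le_sum_of_subset_of_nonneg (Finset.subset_univ _) fun _ _ _ => by positivity
      _ = (6 / 5 * (625 / 1296 + 1)) ^ k := by
        have := Fintype.sum_pow_mul_eq_add_pow (Fin k) (625 / 1296 : ℝ) 1
        simp only [one_pow, mul_one, Fintype.card_fin] at this
        rw [← Finset.mul_sum, this, mul_pow]
      _ ≤ (89 / 50) ^ k := by gcongr; norm_num
  have hcount' : (2 : ℝ) ^ k ≤ 𝒞.card * (89 / 50) ^ k := by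
    calc (2 : ℝ) ^ k ≤ 𝒞.card * W.card := by exact_mod_cast hcount
      _ ≤ _ := by gcongr
  refine le_of_mul_le_mul_right (le_trans ?_ hcount') (by positivity : (0 : ℝ) < (89 / 50) ^ k)
  rw [← mul_pow]
  gcongr
  norm_num

/-- Exponentially many `m`-subsets of `Fin n`, contained in a common set of size at most `2 m`,
with pairwise differences of size at least `k / 4`. -/
theorem exists_separated_subsets {m n k : ℕ} (hkm : k ≤ m) (hkn : m + k ≤ n) :
    ∃ (I : Finset (Fin n)) (𝒮 : Finset (Finset (Fin n))), I.card ≤ 2 * m ∧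
      (11 / 10 : ℝ) ^ k ≤ 𝒮.card ∧ (∀ S ∈ 𝒮, S ⊆ I ∧ S.card = m) ∧
      ∀ S ∈ 𝒮, ∀ T ∈ 𝒮, S ≠ T → k ≤ 4 * (T \ S).card := by
  obtain ⟨𝒞, hcard, hdist⟩ := exists_binary_code k
  let f : Finset (Fin k) → Fin m → Fin n := fun B t =>
    if h : ∃ ht : (t : ℕ) < k, (⟨t, ht⟩ : Fin k) ∈ B
    then ⟨m + t, by have := h.1; omega⟩ else ⟨t, by omega⟩
  have hmod : ∀ B t, (f B t : ℕ) % m = t := fun B t => by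
    dsimp only [f]
    split_ifs
    · simp [Nat.mod_eq_of_lt t.2]
    · exact Nat.mod_eq_of_lt t.2
  have hinj : ∀ B B' t t', f B t = f B' t' → t = t' := fun B B' t t' h => by
    ext
    rw [← hmod B t, ← hmod B' t', h]
  let Φ : Finset (Fin k) → Finset (Fin n) := fun B => Finset.univ.image (f B)
  have hdiff : ∀ B B', (symmDiff B B').card ≤ (Φ B' \ Φ B).card := fun B B' => by
    refine Finset.card_le_card_of_injOn (fun t => f B' (Fin.castLE hkm t)) (fun t ht => ?_) ?_
    · refine Finset.mem_coe.2 (Finset.mem_sdiff.2 ⟨Finset.mem_image_of_mem _ (Finset.mem_univ _), ?_⟩)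
      intro hmem
      obtain ⟨t', -, ht'⟩ := Finset.mem_image.1 hmem
      obtain rfl := hinj _ _ _ _ ht'
      have hval := congrArg Fin.val ht'
      have htm : 0 < m := (Fin.castLE hkm t).pos
      rw [Finset.mem_coe, Finset.mem_symmDiff] at ht
      by_cases h1 : t ∈ B <;> by_cases h2 : t ∈ B' <;> simp [f, h1, h2] at ht hval <;> omega
    · intro t _ t' _ h
      exact Fin.castLE_injective hkm (hinj _ _ _ _ h)
  have hΦ : Set.InjOn Φ 𝒞 := fun B hB B' hB' h => by
    have h0 := hdiff B B'
    rw [h, Finset.sdiff_self, Finset.card_empty, Nat.le_zero, Finset.card_eq_zero] at h0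
    exact symmDiff_eq_bot.1 h0
  refine ⟨Finset.univ.filter fun i => (i : ℕ) < 2 * m, 𝒞.image Φ, ?_, ?_, ?_, ?_⟩
  · calc _ ≤ (Finset.range (2 * m)).card := by
          refine Finset.card_le_card_of_injOn Fin.val (fun i hi => ?_) Fin.val_injective.injOn
          simpa using hi
      _ = 2 * m := Finset.card_range _
  · rwa [Finset.card_image_of_injOn hΦ]
  · intro S hS
    obtain ⟨B, -, rfl⟩ := Finset.mem_image.1 hS
    refine ⟨fun i hi => ?_, ?_⟩
    · obtain ⟨t, -, rfl⟩ := Finset.mem_image.1 hi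
      refine Finset.mem_filter.2 ⟨Finset.mem_univ _, ?_⟩
      dsimp only [f]
      have := t.2
      split_ifs <;> simp <;> omega
    · rw [Finset.card_image_of_injective _ fun t t' h => hinj _ _ _ _ h, Finset.card_fin]
  · intro S hS T hT hST
    obtain ⟨B, hB, rfl⟩ := Finset.mem_image.1 hS
    obtain ⟨B', hB', rfl⟩ := Finset.mem_image.1 hT
    have h1 := hdist B hB B' hB' fun h => hST (by rw [h])
    have h2 := hdiff B B'
    omega

end Code

section Bands

variable {E : Type*} [NormedAddCommGroup E] [InnerProductSpace ℝ E] [FiniteDimensional ℝ E]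
  [MeasurableSpace E] [BorelSpace E] {ι : Type*} [DecidableEq ι]

/-- For well-conditioned `A`, the bands around the spans of a family of subsets have nearly
disjoint union. -/
theorem card_mul_sub_le_stdGaussian_cthickening {A : ι → E} {I : Finset ι}
    {𝒮 : Finset (Finset ι)} (hd : 0 < Module.finrank ℝ E)
    (h𝒮 : ∀ S ∈ 𝒮, S ⊆ I ∧ S.card + 1 = Module.finrank ℝ E)
    (hli : ∀ S ∈ 𝒮, LinearIndependent ℝ fun i : {i // i ∈ S} => A i)
    (hop : ∀ w : E, ∑ i ∈ I, inner ℝ w (A i) ^ 2 ≤ 64 * Module.finrank ℝ E * ‖w‖ ^ 2)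
    {δ : ℝ} (hδ : 0 < δ)
    (hsep : ∀ S ∈ 𝒮, ∀ T ∈ 𝒮, S ≠ T → ∀ u : E, ‖u‖ = 1 → (∀ i ∈ S, inner ℝ u (A i) = 0) →
      δ * Module.finrank ℝ E < ∑ i ∈ T \ S, inner ℝ u (A i) ^ 2)
    {ε : ℝ} (hε : 0 ≤ ε) (hε' : ε ≤ 1 / 2) :
    𝒮.card * (ENNReal.ofReal (3 / 2 * ε / Real.sqrt (2 * Real.pi)) -
        𝒮.card * ENNReal.ofReal (ε * (2 * ε / Real.sqrt (δ / (64 + δ))))) ≤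
      ProbabilityTheory.stdGaussian E
        (Metric.cthickening ε (⋃ S ∈ 𝒮, (Submodule.span ℝ (A '' ↑S) : Set E))) := by
  have hnormal : ∀ S ∈ 𝒮, ∃ u : E, ‖u‖ = 1 ∧
      Submodule.span ℝ (A '' ↑S) = (Submodule.span ℝ {u})ᗮ := fun S hS => by
    obtain ⟨u, hu, h⟩ := exists_unit_normal (hli S hS) (by simpa using (h𝒮 S hS).2)
    refine ⟨u, hu, ?_⟩
    rw [← h, Set.image_eq_range]
    rfl
  choose! u hu hspan using hnormal
  have horth : ∀ S ∈ 𝒮, ∀ i ∈ S, inner ℝ (u S) (A i) = 0 := fun S hS i hi => by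
    rw [← Submodule.mem_orthogonal_singleton_iff_inner_right, ← hspan S hS]
    exact Submodule.subset_span (Set.mem_image_of_mem _ hi)
  have hs : 0 < Real.sqrt (δ / (64 + δ)) := Real.sqrt_pos.2 (by positivity)
  refine (card_mul_sub_le_measure_biUnion (ProbabilityTheory.stdGaussian E) 𝒮
    (B := fun S => {x | |inner ℝ (u S) x| ≤ ε}) (fun S _ => ?_) (fun S hS => ?_)
    (fun S hS T hT hST => ?_)).trans (measure_mono ?_)
  · exact measurableSet_le (by fun_prop) measurable_const
  · rw [stdGaussian_strip (hu S hS)]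
    exact le_gaussianReal_Icc hε hε'
  · refine stdGaussian_strip_inter_le (hu S hS) (hu T hT) hs hε ?_
    have h := mul_inner_sq_le (Finset.sdiff_subset.trans (h𝒮 T hT).1) hop (hu S hS) (hu T hT)
      (fun i hi => horth T hT i (Finset.mem_sdiff.1 hi).1)
      (hsep S hS T hT hST (u S) (hu S hS) (horth S hS)).le
    have hd' : (0 : ℝ) < Module.finrank ℝ E := by exact_mod_cast hd
    rw [Real.sq_sqrt (by positivity), div_le_iff₀ (by positivity)]
    have h' := le_of_mul_le_mul_left (a := (Module.finrank ℝ E : ℝ))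
      (b := δ * inner ℝ (u S) (u T) ^ 2) (c := 64 * (1 - inner ℝ (u S) (u T) ^ 2))
      (by linarith) hd'
    linarith
  · refine Set.iUnion₂_subset fun S hS => ?_
    refine (strip_subset_cthickening (hu S hS) (hspan S hS) ε).trans ?_
    exact Metric.cthickening_subset_of_subset ε
      (Set.subset_biUnion_of_mem (u := fun S : Finset ι => (Submodule.span ℝ (A '' ↑S) : Set E)) hS)

/-- A standard Gaussian family is well-conditioned with high probability. -/
theorem measure_not_wellConditioned_le [Fintype ι] {I : Finset ι} {𝒮 : Finset (Finset ι)}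
    (hI : I.card ≤ 2 * Module.finrank ℝ E)
    (h𝒮 : ∀ S ∈ 𝒮, S.card + 1 = Module.finrank ℝ E) {a : ℝ} (ha : 0 < a) {b : ℝ}
    (hb : ∀ S ∈ 𝒮, ∀ T ∈ 𝒮, S ≠ T → (Real.sqrt (1 + 2 * a))⁻¹ ^ (T \ S).card ≤ b) :
    (Measure.pi fun _ : ι => ProbabilityTheory.stdGaussian E)
        {A | ¬ ((∀ S ∈ 𝒮, LinearIndependent ℝ fun i : {i // i ∈ S} => A i) ∧
          (∀ w : E, ∑ i ∈ I, inner ℝ w (A i) ^ 2 ≤ 64 * Module.finrank ℝ E * ‖w‖ ^ 2) ∧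
          ∀ S ∈ 𝒮, ∀ T ∈ 𝒮, S ≠ T → ∀ u : E, ‖u‖ = 1 → (∀ i ∈ S, inner ℝ u (A i) = 0) →
            1 / a * Module.finrank ℝ E < ∑ i ∈ T \ S, inner ℝ u (A i) ^ 2)} ≤
      ENNReal.ofReal (Real.exp (-Module.finrank ℝ E)) +
        𝒮.card ^ 2 * ENNReal.ofReal (Real.exp (Module.finrank ℝ E) * b) := by
  set d := Module.finrank ℝ E
  set P := Measure.pi fun _ : ι => ProbabilityTheory.stdGaussian E
  set D : Finset ι × Finset ι → Set (ι → E) := fun q =>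
    {A | ∃ u : E, ‖u‖ = 1 ∧ (∀ i ∈ q.1, inner ℝ u (A i) = 0) ∧
      ∑ i ∈ q.2 \ q.1, inner ℝ u (A i) ^ 2 ≤ 1 / a * d} with hD
  have hdep : P {A | ¬ ∀ S ∈ 𝒮, LinearIndependent ℝ fun i : {i // i ∈ S} => A i} = 0 := by
    refine ae_iff.1 ((Finset.eventually_all 𝒮).2 fun S hS => ?_)
    exact ae_linearIndependent_finset S (by have := h𝒮 S hS; omega)
  have hpairs : P (⋃ q ∈ 𝒮.offDiag, D q) ≤ 𝒮.card ^ 2 * ENNReal.ofReal (Real.exp d * b) := by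
    refine (measure_biUnion_finset_le _ _).trans ?_
    calc ∑ q ∈ 𝒮.offDiag, P (D q)
        ≤ ∑ _q ∈ 𝒮.offDiag, ENNReal.ofReal (Real.exp d * b) := by
          refine Finset.sum_le_sum fun q hq => ?_
          obtain ⟨h1, h2, h12⟩ := Finset.mem_offDiag.1 hq
          refine (measure_exists_unit_normal_le Finset.disjoint_sdiff (h𝒮 _ h1) ha _).trans
            (ENNReal.ofReal_le_ofReal ?_)
          rw [show a * (1 / a * (d : ℝ)) = d by field_simp]
          gcongr
          exact hb _ h1 _ h2 h12
      _ ≤ 𝒮.card ^ 2 * ENNReal.ofReal (Real.exp d * b) := by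
          rw [Finset.sum_const, nsmul_eq_mul, Finset.offDiag_card]
          gcongr
          rw [sq]
          exact_mod_cast Nat.sub_le _ _
  have hop := measure_sum_inner_sq_gt_le I hI
  refine (measure_mono (t := {A | ¬ ∀ S ∈ 𝒮, LinearIndependent ℝ fun i : {i // i ∈ S} => A i} ∪
    ({A | ¬ ∀ w : E, ∑ i ∈ I, inner ℝ w (A i) ^ 2 ≤ 64 * d * ‖w‖ ^ 2} ∪
      ⋃ q ∈ 𝒮.offDiag, D q)) fun A hA => ?_).trans ?_
  · by_contra hcon
    simp only [Set.mem_union, Set.mem_ofPred_eq, not_or, not_not] at hcon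
    obtain ⟨h1, h2, h3⟩ := hcon
    refine hA ⟨h1, h2, fun S hS T hT hST u hu huS => ?_⟩
    by_contra hle
    exact h3 (Set.mem_biUnion (x := (S, T)) (Finset.mem_offDiag.2 ⟨hS, hT, hST⟩)
      ⟨u, hu, huS, not_lt.1 hle⟩)
  · refine (measure_union_le _ _).trans ?_
    rw [hdep, zero_add]
    exact (measure_union_le _ _).trans (add_le_add hop hpairs)

end Bands

theorem stdGaussian_eq (d : ℕ) :
    stdGaussian d = ProbabilityTheory.stdGaussian (EuclideanSpace ℝ (Fin d)) :=
  map_pi_eq_stdGaussian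

theorem mul_div_le_card_mul_sub {c ε s K r : ℝ} (hc : 0 ≤ c) (hε : 0 ≤ ε) (hs : 0 < s)
    (hr : 0 < r) (hr3 : r ≤ 3) (hK1 : c ≤ K) (hK2 : K ≤ 2 * c) (hcs : 24 * (c * ε) ≤ s) :
    c * ε / r ≤ K * (3 / 2 * ε / r - K * (ε * (2 * ε / s))) := by
  have hK0 : 0 ≤ K := hc.trans hK1
  have herr : K * (ε * (2 * ε / s)) ≤ 1 / 2 * ε / r := by
    calc K * (ε * (2 * ε / s)) ≤ 2 * c * (ε * (2 * ε / s)) := by gcongr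
      _ = 24 * (c * ε) / s * (ε / 6) := by ring
      _ ≤ 1 * (ε / 6) := by
          gcongr
          exact (div_le_one hs).2 hcs
      _ = 1 / 2 * ε / 3 := by ring
      _ ≤ 1 / 2 * ε / r := by gcongr
  calc c * ε / r = c * (ε / r) := by ring
    _ ≤ K * (ε / r) := by gcongr
    _ = K * (3 / 2 * ε / r - 1 / 2 * ε / r) := by ring
    _ ≤ _ := by gcongr

theorem exp_neg_add_sq_mul_le {K x : ℝ} (hK0 : 0 ≤ K) (hK : K ≤ 2 * Real.exp x) :
    Real.exp (-x) + K ^ 2 * (Real.exp x * Real.exp (-(4 * x))) ≤ 5 * Real.exp (-x) := by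
  calc Real.exp (-x) + K ^ 2 * (Real.exp x * Real.exp (-(4 * x)))
      ≤ Real.exp (-x) + (2 * Real.exp x) ^ 2 * (Real.exp x * Real.exp (-(4 * x))) := by gcongr
    _ = Real.exp (-x) + 4 * Real.exp (2 * x + (x + -(4 * x))) := by
        rw [Real.exp_add, Real.exp_add, mul_pow, ← Real.exp_nat_mul]
        norm_num
        ring
    _ = 5 * Real.exp (-x) := by ring_nf

set_option maxHeartbeats 1000000 in
/-- Lemma (lower bound on the union of bands): for `d ≥ 2` and `A₁, …, A_n` iid standard
Gaussians in `ℝ^d` with `n/(d-1) ≥ c₀ > 1`, there exist constants `c₂, c₄ > 1` (depending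
only on `c₀`) such that whenever `0 ≤ ε ≤ 1/(c₄ c₂^{d-1})`, with probability at least
`1 - c₄ e^{-d}` the Gaussian measure of the `ε`-neighborhood of the union of the spans of
all `(d-1)`-element subsets of the points is at least `c₂^{d-1} ε / √(2π)`. -/
theorem stmt12 (c₀ : ℝ) (hc₀ : 1 < c₀) :
    ∃ c₂ c₄ : ℝ, 1 < c₂ ∧ 1 < c₄ ∧
      ∀ d n : ℕ, 2 ≤ d → c₀ ≤ (n : ℝ) / ((d : ℝ) - 1) →
        ∀ ε : ℝ, 0 ≤ ε → ε ≤ 1 / (c₄ * c₂ ^ (d - 1)) →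
          ENNReal.ofReal (1 - c₄ * Real.exp (-(d : ℝ))) ≤
            (Measure.pi fun _ : Fin n => stdGaussian d)
              {A : Fin n → EuclideanSpace ℝ (Fin d) |
                ENNReal.ofReal (c₂ ^ (d - 1) * ε / Real.sqrt (2 * Real.pi)) ≤
                  stdGaussian d
                    (Metric.cthickening ε
                      (⋃ S ∈ {S : Finset (Fin n) | S.card = d - 1},
                        (Submodule.span ℝ (A '' ↑S) : Set (EuclideanSpace ℝ (Fin d)))))} := by
  set κ : ℝ := min 1 (c₀ - 1) with hκ
  have hκ0 : 0 < κ := lt_min one_pos (by linarith)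
  have hκ1 : κ ≤ 1 := min_le_left _ _
  set c₂ : ℝ := (11 / 10 : ℝ) ^ κ with hc₂
  have hc₂1 : 1 < c₂ := Real.one_lt_rpow (by norm_num) hκ0
  have hc₂e : c₂ ≤ Real.exp 1 := by
    have h1 : c₂ ≤ (11 / 10 : ℝ) ^ (1 : ℝ) := Real.rpow_le_rpow_of_exponent_le (by norm_num) hκ1
    rw [Real.rpow_one] at h1
    linarith [Real.exp_one_gt_d9]
  set a : ℝ := (Real.exp (64 / κ) - 1) / 2 with ha_def
  have ha : 0 < a := by
    have : 1 < Real.exp (64 / κ) := Real.one_lt_exp_iff.2 (by positivity)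
    rw [ha_def]; linarith
  have hsqrt : (Real.sqrt (1 + 2 * a))⁻¹ = Real.exp (-(32 / κ)) := by
    rw [show 1 + 2 * a = Real.exp (32 / κ) ^ 2 by
      rw [← Real.exp_nat_mul, ha_def]; push_cast; ring_nf,
      Real.sqrt_sq (Real.exp_pos _).le, Real.exp_neg]
  set s : ℝ := Real.sqrt (1 / a / (64 + 1 / a)) with hs_def
  have hs : 0 < s := Real.sqrt_pos.2 (by positivity)
  refine ⟨c₂, 5 + 24 / s, hc₂1, by have : 0 < 24 / s := by positivity
                                   linarith, ?_⟩
  set c₄ : ℝ := 5 + 24 / s with hc₄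
  have hc₄5 : 5 ≤ c₄ := by have : 0 < 24 / s := by positivity
                           linarith
  intro d n hd hn ε hε hε'
  obtain ⟨m, rfl⟩ : ∃ m, d = m + 1 := ⟨d - 1, by omega⟩
  have hm1 : (1 : ℝ) ≤ m := by exact_mod_cast (by omega : 1 ≤ m)
  simp only [Nat.add_sub_cancel] at hε' ⊢
  have hn' : c₀ * m ≤ n := by
    rwa [Nat.cast_succ, add_sub_cancel_right, le_div_iff₀ (by linarith)] at hn
  have hmn : m ≤ n := by
    have : (m : ℝ) ≤ n := le_trans (by nlinarith) hn'
    exact_mod_cast this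
  set k := min m (n - m) with hk
  have hκk : κ * m ≤ k := by
    rw [hk, Nat.cast_min, Nat.cast_sub hmn]
    refine le_min (by nlinarith) ?_
    have : κ ≤ c₀ - 1 := min_le_right _ _
    nlinarith
  obtain ⟨I, 𝒮₀, hI, hcard₀, hsub₀, hdiff₀⟩ := exists_separated_subsets (m := m) (n := n) (k := k)
    (min_le_left _ _) (by omega)
  have hpow : c₂ ^ m ≤ (11 / 10 : ℝ) ^ k := by
    rw [hc₂, ← Real.rpow_mul_natCast (by norm_num), ← Real.rpow_natCast _ k]
    exact Real.rpow_le_rpow_of_exponent_le (by norm_num) hκk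
  have hc₂m : 1 ≤ c₂ ^ m := one_le_pow₀ hc₂1.le
  obtain ⟨𝒮, h𝒮sub, h𝒮card⟩ := Finset.exists_subset_card_eq (Nat.ceil_le.2 (hpow.trans hcard₀))
  have hK1 : c₂ ^ m ≤ 𝒮.card := h𝒮card ▸ Nat.le_ceil _
  have hK2 : (𝒮.card : ℝ) ≤ 2 * c₂ ^ m := by
    have := Nat.ceil_lt_add_one (zero_le_one.trans hc₂m)
    rw [← h𝒮card] at this
    linarith
  have hrank : Module.finrank ℝ (EuclideanSpace ℝ (Fin (m + 1))) = m + 1 := by simp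
  have h𝒮 : ∀ S ∈ 𝒮, S ⊆ I ∧ S.card + 1 = Module.finrank ℝ (EuclideanSpace ℝ (Fin (m + 1))) :=
    fun S hS => ⟨(hsub₀ S (h𝒮sub hS)).1, by rw [hrank, (hsub₀ S (h𝒮sub hS)).2]⟩
  have hb : ∀ S ∈ 𝒮, ∀ T ∈ 𝒮, S ≠ T →
      (Real.sqrt (1 + 2 * a))⁻¹ ^ (T \ S).card ≤ Real.exp (-(4 * (m + 1))) := by
    intro S hS T hT hST
    have h4 : (k : ℝ) ≤ 4 * (T \ S).card := by
      exact_mod_cast hdiff₀ S (h𝒮sub hS) T (h𝒮sub hT) hST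
    rw [hsqrt, ← Real.exp_nat_mul, Real.exp_le_exp, mul_neg, neg_le_neg_iff, mul_div_assoc',
      le_div_iff₀ hκ0]
    nlinarith
  have hbad := measure_not_wellConditioned_le (E := EuclideanSpace ℝ (Fin (m + 1))) (I := I)
    (𝒮 := 𝒮) (by rw [hrank]; omega) (fun S hS => (h𝒮 S hS).2) ha hb
  simp only [stdGaussian_eq]
  set P := Measure.pi fun _ : Fin n =>
    ProbabilityTheory.stdGaussian (EuclideanSpace ℝ (Fin (m + 1)))
  have htotal : ENNReal.ofReal (Real.exp (-Module.finrank ℝ (EuclideanSpace ℝ (Fin (m + 1))))) +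
      𝒮.card ^ 2 * ENNReal.ofReal (Real.exp (Module.finrank ℝ (EuclideanSpace ℝ (Fin (m + 1)))) *
        Real.exp (-(4 * (m + 1)))) ≤ ENNReal.ofReal (c₄ * Real.exp (-((m + 1 : ℕ) : ℝ))) := by
    rw [hrank, ← ENNReal.ofReal_natCast 𝒮.card, ← ENNReal.ofReal_pow (by positivity),
      ← ENNReal.ofReal_mul (by positivity), ← ENNReal.ofReal_add (by positivity) (by positivity)]
    refine ENNReal.ofReal_le_ofReal ?_
    push_cast
    have hcm : c₂ ^ m ≤ Real.exp (m + 1) := by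
      calc c₂ ^ m ≤ Real.exp 1 ^ m := by gcongr
        _ = Real.exp m := by rw [← Real.exp_nat_mul, mul_one]
        _ ≤ Real.exp (m + 1) := Real.exp_le_exp.2 (by linarith)
    calc Real.exp (-(m + 1)) + (𝒮.card : ℝ) ^ 2 * (Real.exp (m + 1) * Real.exp (-(4 * (m + 1))))
        ≤ 5 * Real.exp (-(m + 1)) := exp_neg_add_sq_mul_le (Nat.cast_nonneg _) (by linarith)
      _ ≤ c₄ * Real.exp (-(m + 1)) := by gcongr
  have hc₄ε : c₄ * (c₂ ^ m * ε) ≤ 1 := by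
    rw [le_div_iff₀ (by positivity)] at hε'
    linarith
  have hεhalf : ε ≤ 1 / 2 := by nlinarith [mul_nonneg (sub_nonneg.2 hc₂m) hε]
  have hgood : ∀ A : Fin n → EuclideanSpace ℝ (Fin (m + 1)),
      ((∀ S ∈ 𝒮, LinearIndependent ℝ fun i : {i // i ∈ S} => A i) ∧
        (∀ w, ∑ i ∈ I, inner ℝ w (A i) ^ 2 ≤
          64 * Module.finrank ℝ (EuclideanSpace ℝ (Fin (m + 1))) * ‖w‖ ^ 2) ∧
        ∀ S ∈ 𝒮, ∀ T ∈ 𝒮, S ≠ T → ∀ u, ‖u‖ = 1 → (∀ i ∈ S, inner ℝ u (A i) = 0) →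
          1 / a * Module.finrank ℝ (EuclideanSpace ℝ (Fin (m + 1))) <
            ∑ i ∈ T \ S, inner ℝ u (A i) ^ 2) →
      ENNReal.ofReal (c₂ ^ m * ε / Real.sqrt (2 * Real.pi)) ≤
        ProbabilityTheory.stdGaussian (EuclideanSpace ℝ (Fin (m + 1)))
          (Metric.cthickening ε (⋃ S ∈ {S : Finset (Fin n) | S.card = m},
            (Submodule.span ℝ (A '' ↑S) : Set (EuclideanSpace ℝ (Fin (m + 1)))))) := by
    rintro A ⟨hli, hop, hsep⟩
    have hmain := card_mul_sub_le_stdGaussian_cthickening (by omega) h𝒮 hli hop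
      (by positivity) hsep hε hεhalf
    refine le_trans ?_ (hmain.trans (measure_mono (Metric.cthickening_subset_of_subset ε ?_)))
    · rw [← hs_def, ← ENNReal.ofReal_natCast 𝒮.card, ← ENNReal.ofReal_mul (by positivity),
        ← ENNReal.ofReal_sub _ (by positivity), ← ENNReal.ofReal_mul (by positivity)]
      refine ENNReal.ofReal_le_ofReal ?_
      have hroot0 : 0 < Real.sqrt (2 * Real.pi) := by positivity
      have hroot : Real.sqrt (2 * Real.pi) ≤ 3 :=
        Real.sqrt_le_iff.2 ⟨by norm_num, by nlinarith [Real.pi_lt_d2]⟩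
      have hcs : 24 * (c₂ ^ m * ε) ≤ s := by
        have h1 : 24 / s * (c₂ ^ m * ε) ≤ 1 :=
          le_trans (mul_le_mul_of_nonneg_right (by linarith) (by positivity)) hc₄ε
        rwa [div_mul_eq_mul_div, div_le_one hs] at h1
      exact mul_div_le_card_mul_sub (by positivity) hε hs hroot0 hroot hK1 hK2 hcs
    · refine Set.iUnion₂_subset fun S hS => ?_
      exact Set.subset_biUnion_of_mem
        (u := fun S : Finset (Fin n) =>
          (Submodule.span ℝ (A '' ↑S) : Set (EuclideanSpace ℝ (Fin (m + 1)))))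
        (show S ∈ {S : Finset (Fin n) | S.card = m} from (hsub₀ S (h𝒮sub hS)).2)
  rw [ENNReal.ofReal_sub _ (by positivity), ENNReal.ofReal_one, tsub_le_iff_right]
  calc (1 : ENNReal) = P Set.univ := measure_univ.symm
    _ ≤ P (_ ∪ _) := measure_mono fun A _ => by
        exact (em _).imp (fun h => hgood A h) id
    _ ≤ _ := (measure_union_le _ _).trans (add_le_add_right (hbad.trans htotal) _)
end
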